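/- arXiv:1810.01659 — 4 statements merged into one kernel-verified Lean document; each statement's English description precedes it below -/
import Mathlib

section
/- Let ψ ∈ C_c^∞(ℝ³;ℂ⁴) and let R > 0. Then ∫_{ℝ³} |x| |(−iα·∇ψ)(x)|² dx ≥ ∫_{ℝ³} |ψ(x)|²/|x| dx + (1/4) ∫_{ℝ³} |ψ(x) − (R/|x|) ψ(R x/|x|)|² / (|x| (log(|x|/R))²) dx. -/
open MeasureTheory Real Filter

noncomputable section

abbrev E3 := EuclideanSpace ℝ (Fin 3)
abbrev C4 := EuclideanSpace ℂ (Fin 4)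

/-- Pauli matrices. -/
def pauli : Fin 3 → Matrix (Fin 2) (Fin 2) ℂ
  | 0 => !![0, 1; 1, 0]
  | 1 => !![0, -Complex.I; Complex.I, 0]
  | 2 => !![1, 0; 0, -1]

/-- Dirac matrices αⱼ = [[0, σⱼ], [σⱼ, 0]]. -/
def diracAlpha (j : Fin 3) : Matrix (Fin 4) (Fin 4) ℂ :=
  Matrix.reindex finSumFinEquiv finSumFinEquiv
    (Matrix.fromBlocks 0 (pauli j) (pauli j) 0)

/-- Dirac matrix β = [[I₂, 0], [0, -I₂]]. -/
def diracBeta : Matrix (Fin 4) (Fin 4) ℂ :=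
  Matrix.reindex finSumFinEquiv finSumFinEquiv
    (Matrix.fromBlocks (1 : Matrix (Fin 2) (Fin 2) ℂ) 0 0 (-1 : Matrix (Fin 2) (Fin 2) ℂ))

/-- Block-diagonal matrix diag(σⱼ, σⱼ) (twice the spin angular momentum matrices). -/
def spinMat (j : Fin 3) : Matrix (Fin 4) (Fin 4) ℂ :=
  Matrix.reindex finSumFinEquiv finSumFinEquiv
    (Matrix.fromBlocks (pauli j) 0 0 (pauli j))

/-- Action of a 4 × 4 matrix on ℂ⁴ with the Euclidean norm. -/
def mulVecE (M : Matrix (Fin 4) (Fin 4) ℂ) (v : C4) : C4 :=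
  Matrix.toEuclideanLin M v

/-- The partial derivative ∂ⱼψ(x). -/
def pderiv3 (j : Fin 3) (ψ : E3 → C4) (x : E3) : C4 :=
  fderiv ℝ ψ x (EuclideanSpace.single j 1)

/-- The free Dirac operator (-iα·∇ψ)(x). -/
def diracD (ψ : E3 → C4) (x : E3) : C4 :=
  (-Complex.I) • ∑ j : Fin 3, mulVecE (diracAlpha j) (pderiv3 j ψ x)

/-- The radial derivative ∂_rψ(x) = Σⱼ (xⱼ/|x|) ∂ⱼψ(x). -/
def radialDeriv (ψ : E3 → C4) (x : E3) : C4 :=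
  ∑ j : Fin 3, (x j / ‖x‖) • pderiv3 j ψ x

/-- The orbital angular momentum (Lⱼψ)(x) = -i (x × ∇)ⱼ ψ(x). -/
def angMom (j : Fin 3) (ψ : E3 → C4) (x : E3) : C4 :=
  (-Complex.I) • ((x (j + 1)) • pderiv3 (j + 2) ψ x - (x (j + 2)) • pderiv3 (j + 1) ψ x)

/-- The spin-orbit term (2S·Lψ)(x) = Σⱼ diag(σⱼ,σⱼ) (Lⱼψ)(x). -/
def twoSL (ψ : E3 → C4) (x : E3) : C4 :=
  ∑ j : Fin 3, mulVecE (spinMat j) (angMom j ψ x)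

/-- Polar coordinates for the lower Lebesgue integral. -/
theorem lintegral_polar {E : Type*} [NormedAddCommGroup E] [NormedSpace ℝ E] [MeasurableSpace E]
    [BorelSpace E] [FiniteDimensional ℝ E] [Nontrivial E] (μ : Measure E) [μ.IsAddHaarMeasure]
    {f : E → ENNReal} (hf : Measurable f) :
    ∫⁻ x, f x ∂μ = ∫⁻ ω : Metric.sphere (0 : E) 1, (∫⁻ r in Set.Ioi (0 : ℝ),
      ENNReal.ofReal (r ^ (Module.finrank ℝ E - 1)) * f (r • (ω : E))) ∂μ.toSphere := by
  have hemb := (homeomorphUnitSphereProd E).measurableEmbedding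
  calc ∫⁻ x, f x ∂μ = ∫⁻ x in ({0}ᶜ : Set E), f x ∂μ := by
        rw [setLIntegral_congr (t := Set.univ) (by simp), setLIntegral_univ]
    _ = ∫⁻ x : ({0}ᶜ : Set E), f x ∂(μ.comap Subtype.val) := by
        rw [lintegral_subtype_comap (measurableSet_singleton _).compl]
    _ = ∫⁻ p, f (((homeomorphUnitSphereProd E).symm p : ({0}ᶜ : Set E)) : E)
          ∂(μ.toSphere.prod (Measure.volumeIoiPow (Module.finrank ℝ E - 1))) := by
        rw [← (Measure.measurePreserving_homeomorphUnitSphereProd μ).lintegral_comp_emb hemb]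
        simp
    _ = ∫⁻ ω : Metric.sphere (0 : E) 1, ∫⁻ r : Set.Ioi (0 : ℝ), f ((r : ℝ) • (ω : E))
          ∂(Measure.volumeIoiPow (Module.finrank ℝ E - 1)) ∂μ.toSphere := by
        rw [lintegral_prod]
        · simp
        · simp only [homeomorphUnitSphereProd_symm_apply_coe]
          exact (hf.comp (by fun_prop)).aemeasurable
    _ = _ := by
        refine lintegral_congr fun ω => ?_
        have hm : Measurable fun r : Set.Ioi (0 : ℝ) => f ((r : ℝ) • (ω : E)) :=
          hf.comp (by fun_prop)
        rw [Measure.volumeIoiPow, lintegral_withDensity_eq_lintegral_mul _ (by fun_prop) hm]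
        exact lintegral_subtype_comap (μ := volume) measurableSet_Ioi
          (fun r : ℝ => ENNReal.ofReal (r ^ (Module.finrank ℝ E - 1)) * f (r • (ω : E)))

/-- If `Ψ' = p ≥ q ≥ 0` on `(a, b)` and `Ψ` is continuous on `[a, b]`, then the integral of `q`
is at most the increment of `Ψ`. -/
theorem lintegral_Ioo_le_sub_of_hasDerivAt {Ψ p q : ℝ → ℝ} {a b : ℝ} (hab : a ≤ b)
    (hc : ContinuousOn Ψ (Set.Icc a b)) (hd : ∀ r ∈ Set.Ioo a b, HasDerivAt Ψ (p r) r)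
    (hq : ∀ r ∈ Set.Ioo a b, 0 ≤ q r) (hpq : ∀ r ∈ Set.Ioo a b, q r ≤ p r) :
    ∫⁻ r in Set.Ioo a b, ENNReal.ofReal (q r) ≤ ENNReal.ofReal (Ψ b - Ψ a) := by
  have hp : ∀ r ∈ Set.Ioo a b, 0 ≤ p r := fun r hr => (hq r hr).trans (hpq r hr)
  have hi := intervalIntegral.integrableOn_deriv_of_nonneg hc hd hp
  have h := intervalIntegral.integral_eq_sub_of_hasDerivAt_of_le hab hc hd
    ((intervalIntegrable_iff_integrableOn_Ioc_of_le hab).2 hi)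
  rw [← h, intervalIntegral.integral_of_le hab, integral_Ioc_eq_integral_Ioo,
    ofReal_integral_eq_lintegral_ofReal (hi.mono_set Set.Ioo_subset_Ioc_self)
      ((ae_restrict_iff' measurableSet_Ioo).2 (ae_of_all _ hp))]
  exact setLIntegral_mono' measurableSet_Ioo fun r hr => ENNReal.ofReal_le_ofReal (hpq r hr)

/-- If `h` is differentiable at `R` and vanishes there, then `‖h‖² / (2 log (r / R))` tends to `0`
at `R`. -/
theorem continuousAt_normSq_div_log {F : Type*} [NormedAddCommGroup F] [NormedSpace ℝ F]
    {h : ℝ → F} {R : ℝ} (hR : 0 < R) {h' : F} (hh : HasDerivAt h h' R) (h0 : h R = 0) :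
    ContinuousAt (fun r => ‖h r‖ ^ 2 / (2 * Real.log (r / R))) R := by
  have hlog : HasDerivAt (fun r => Real.log (r / R)) R⁻¹ R := by
    have := ((hasDerivAt_id R).div_const R).log (by simp [hR.ne'])
    simpa [hR.ne'] using this
  have e1 := (hasDerivAt_iff_tendsto_slope.1 hh).norm.pow 2
  have e2 := (hasDerivAt_iff_tendsto_slope.1 hlog).const_mul 2
  have e3 : Tendsto (fun r => r - R) (nhdsWithin R {R}ᶜ) (nhds 0) := by
    have : ContinuousAt (fun r : ℝ => r - R) R := by fun_prop
    simpa using this.tendsto.mono_left nhdsWithin_le_nhds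
  have e4 := (e1.div e2 (by positivity)).mul e3
  rw [continuousAt_iff_punctured_nhds]
  simp only [h0, norm_zero, div_self hR.ne', Real.log_one]
  rw [mul_zero] at e4
  simp only [ne_eq, OfNat.ofNat_ne_zero, not_false_eq_true, zero_pow, mul_zero, div_zero]
  refine e4.congr' ?_
  filter_upwards [self_mem_nhdsWithin] with r hr
  have hr' : r - R ≠ 0 := sub_ne_zero.2 hr
  simp only [Pi.div_apply, slope_def_module, h0, sub_zero, div_self hR.ne', Real.log_one,
    norm_smul, norm_inv, Real.norm_eq_abs, smul_eq_mul, mul_pow, inv_pow, sq_abs]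
  by_cases hl : Real.log (r / R) = 0
  · simp [hl]
  · field_simp

/-- One-dimensional Hardy-type inequality with logarithmic remainder along a ray. -/
theorem lintegral_ray_hardy_log {F : Type*} [NormedAddCommGroup F] [InnerProductSpace ℝ F]
    {f : ℝ → F} (hf : ContDiff ℝ 1 f) {B : ℝ} (hB : ∀ r, B ≤ r → f r = 0) {R : ℝ} (hR : 0 < R) :
    ∫⁻ r in Set.Ioi (0 : ℝ), ENNReal.ofReal (r * ‖f r‖ ^ 2 +
        r * ‖f r - (R / r) • f R‖ ^ 2 / (4 * Real.log (r / R) ^ 2)) ≤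
      ∫⁻ r in Set.Ioi (0 : ℝ), ENNReal.ofReal (r ^ 3 * ‖deriv f r‖ ^ 2) := by
  set q : ℝ → ℝ := fun r => r * ‖f r‖ ^ 2 +
    r * ‖f r - (R / r) • f R‖ ^ 2 / (4 * Real.log (r / R) ^ 2) with hq
  set G : ℝ → ℝ := fun r => r ^ 3 * ‖deriv f r‖ ^ 2 with hG
  have hfc : Continuous f := hf.continuous
  have hf'c : Continuous (deriv f) := hf.continuous_deriv le_rfl
  have hGc : Continuous G := by fun_prop
  have hfd : ∀ r, HasDerivAt f (deriv f r) r := fun r =>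
    ((hf.differentiable one_ne_zero) r).hasDerivAt
  set h : ℝ → F := fun r => r • f r - R • f R with hh
  have hgd : ∀ r, HasDerivAt (fun r => r • f r) (f r + r • deriv f r) r := fun r => by
    refine ((hasDerivAt_id' r).smul (hfd r)).congr_deriv ?_
    rw [one_smul, add_comm]
  have hhd : ∀ r, HasDerivAt h (f r + r • deriv f r) r := fun r => (hgd r).sub_const _
  set Φ : ℝ → ℝ := fun r => ‖h r‖ ^ 2 / (2 * Real.log (r / R)) with hΦ
  have hlog0 : ∀ r, 0 < r → r ≠ R → Real.log (r / R) ≠ 0 := fun r hr hrR => by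
    refine Real.log_ne_zero_of_pos_of_ne_one (by positivity) fun H => hrR ?_
    field_simp at H
    exact H
  have hlogd : ∀ r, 0 < r → HasDerivAt (fun r => Real.log (r / R)) r⁻¹ r := fun r hr => by
    convert ((hasDerivAt_id' r).div_const R).log (by simp [hR.ne', hr.ne']) using 1
    field_simp
  have hΦd : ∀ r, 0 < r → r ≠ R → HasDerivAt Φ (inner ℝ (h r) (f r + r • deriv f r) /
      Real.log (r / R) - ‖h r‖ ^ 2 / (2 * r * Real.log (r / R) ^ 2)) r := fun r hr hrR => by
    have hl := hlog0 r hr hrR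
    refine ((hhd r).norm_sq.div ((hlogd r hr).const_mul 2) (by positivity)).congr_deriv ?_
    field_simp
  have hΦc : ∀ r, 0 < r → ContinuousAt Φ r := fun r hr => by
    by_cases hrR : r = R
    · subst hrR
      exact continuousAt_normSq_div_log hr (hhd r) (by simp [hh])
    · exact (hΦd r hr hrR).continuousAt
  have key : ∀ a b : ℝ, 0 < a → a < R → R < b → B ≤ b →
      ∫⁻ r in Set.Ioo a b, ENNReal.ofReal (q r) ≤
        ∫⁻ r in Set.Ioi (0 : ℝ), ENNReal.ofReal (G r) := by
    intro a b ha haR hRb hBb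
    set Ψ : ℝ → ℝ := fun r => (∫ s in a..r, G s) - Φ r + ‖r • f r‖ ^ 2 with hΨ
    set p : ℝ → ℝ := fun r => G r - (inner ℝ (h r) (f r + r • deriv f r) /
      Real.log (r / R) - ‖h r‖ ^ 2 / (2 * r * Real.log (r / R) ^ 2)) +
      2 * inner ℝ (r • f r) (f r + r • deriv f r) with hp
    have hint : ∀ r, HasDerivAt (fun r => ∫ s in a..r, G s) (G r) r := fun r =>
      intervalIntegral.integral_hasDerivAt_right (hGc.intervalIntegrable _ _)
        (hGc.stronglyMeasurableAtFilter _ _) hGc.continuousAt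
    have hΨd : ∀ r, 0 < r → r ≠ R → HasDerivAt Ψ (p r) r := fun r hr hrR =>
      ((hint r).sub (hΦd r hr hrR)).add (hgd r).norm_sq
    have hΨc : ∀ r, 0 < r → ContinuousAt Ψ r := fun r hr =>
      ((hint r).continuousAt.sub (hΦc r hr)).add (by fun_prop)
    have hq0 : ∀ r, 0 < r → 0 ≤ q r := fun r hr => by positivity
    have hqp : ∀ r, 0 < r → r ≠ R → q r ≤ p r := fun r hr hrR => by
      have hl := hlog0 r hr hrR
      have hsub : f r - (R / r) • f R = r⁻¹ • h r := by
        simp only [hh, smul_sub, smul_smul]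
        rw [inv_mul_cancel₀ hr.ne', one_smul, div_eq_inv_mul]
      have hsq : 0 ≤ r * ‖(f r + r • deriv f r) - (1 / (2 * r * Real.log (r / R))) • h r‖ ^ 2 := by
        positivity
      have hpq : p r - q r =
          r * ‖(f r + r • deriv f r) - (1 / (2 * r * Real.log (r / R))) • h r‖ ^ 2 := by
        simp only [hp, hq, hG, hsub]
        generalize h r = y
        generalize f r = u
        generalize deriv f r = v
        generalize Real.log (r / R) = t at hl
        simp only [← real_inner_self_eq_norm_sq, inner_sub_left, inner_sub_right, inner_add_left,
          inner_add_right, real_inner_smul_left, real_inner_smul_right]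
        rw [real_inner_comm u v, real_inner_comm u y, real_inner_comm v y]
        field_simp
        ring
      linarith
    have hlow := lintegral_Ioo_le_sub_of_hasDerivAt (Ψ := Ψ) (p := p) (q := q) haR.le
      (fun r hr => (hΨc r (ha.trans_le hr.1)).continuousWithinAt)
      (fun r hr => hΨd r (ha.trans hr.1) hr.2.ne) (fun r hr => hq0 r (ha.trans hr.1))
      (fun r hr => hqp r (ha.trans hr.1) hr.2.ne)
    have hupp := lintegral_Ioo_le_sub_of_hasDerivAt (Ψ := Ψ) (p := p) (q := q) hRb.le
      (fun r hr => (hΨc r (hR.trans_le hr.1)).continuousWithinAt)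
      (fun r hr => hΨd r (hR.trans hr.1) hr.1.ne') (fun r hr => hq0 r (hR.trans hr.1))
      (fun r hr => hqp r (hR.trans hr.1) hr.1.ne')
    have hmono : ∀ c d, 0 < c → c ≤ d →
        (∀ r ∈ Set.Ioo c d, r ≠ R) → Ψ c ≤ Ψ d := fun c d hc hcd hne => by
      refine monotoneOn_of_deriv_nonneg (convex_Icc c d)
        (fun r hr => (hΨc r (hc.trans_le hr.1)).continuousWithinAt) ?_ ?_
        (Set.left_mem_Icc.2 hcd) (Set.right_mem_Icc.2 hcd) hcd
      · intro r hr
        rw [interior_Icc] at hr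
        exact (hΨd r (hc.trans hr.1) (hne r hr)).differentiableAt.differentiableWithinAt
      · intro r hr
        rw [interior_Icc] at hr
        rw [(hΨd r (hc.trans hr.1) (hne r hr)).deriv]
        exact (hq0 r (hc.trans hr.1)).trans (hqp r (hc.trans hr.1) (hne r hr))
    have hm1 := hmono a R ha haR.le fun r hr => hr.2.ne
    have hm2 := hmono R b hR hRb.le fun r hr => hr.1.ne'
    have hΦa : Φ a ≤ 0 := div_nonpos_of_nonneg_of_nonpos (by positivity) <| by
      have := Real.log_nonpos (x := a / R) (by positivity) ((div_le_one hR).2 haR.le)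
      linarith
    have hΦb : 0 ≤ Φ b := div_nonneg (by positivity) <| by
      have := Real.log_nonneg (x := b / R) ((one_le_div hR).2 hRb.le)
      linarith
    calc ∫⁻ r in Set.Ioo a b, ENNReal.ofReal (q r)
        = ∫⁻ r in Set.Ioo a R ∪ Set.Ioo R b, ENNReal.ofReal (q r) := by
          refine setLIntegral_congr ?_
          rw [← Set.Ioc_union_Ioo_eq_Ioo haR.le hRb]
          exact Ioo_ae_eq_Ioc.symm.union (ae_eq_refl _)
      _ ≤ ENNReal.ofReal (Ψ R - Ψ a) + ENNReal.ofReal (Ψ b - Ψ R) :=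
          (lintegral_union_le _ _ _).trans (add_le_add hlow hupp)
      _ = ENNReal.ofReal (Ψ b - Ψ a) := by
          rw [← ENNReal.ofReal_add (by linarith) (by linarith)]
          congr 1; ring
      _ ≤ ENNReal.ofReal (∫ s in a..b, G s) := by
          refine ENNReal.ofReal_le_ofReal ?_
          simp only [hΨ, hB b hBb, intervalIntegral.integral_same, smul_zero, norm_zero]
          nlinarith [sq_nonneg ‖a • f a‖]
      _ = ∫⁻ r in Set.Ioc a b, ENNReal.ofReal (G r) := by
          rw [intervalIntegral.integral_of_le (haR.trans hRb).le,
            ofReal_integral_eq_lintegral_ofReal]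
          · exact (hGc.integrableOn_Icc).mono_set Set.Ioc_subset_Icc_self
          · refine (ae_restrict_iff' measurableSet_Ioc).2 (ae_of_all _ fun r hr => ?_)
            have : 0 < r := ha.trans hr.1
            simp only [Pi.zero_apply, hG]
            positivity
      _ ≤ _ := lintegral_mono_set fun r hr => ha.trans hr.1
  have ha : Tendsto (fun n : ℕ => R / ((n : ℝ) + 2)) atTop (nhds 0) :=
    tendsto_const_nhds.div_atTop
      (tendsto_atTop_add_const_right _ _ tendsto_natCast_atTop_atTop)
  have hb : Tendsto (fun n : ℕ => (n : ℝ) + 1 + R + |B|) atTop atTop :=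
    tendsto_atTop_add_const_right _ _ <| tendsto_atTop_add_const_right _ _ <|
      tendsto_atTop_add_const_right _ _ tendsto_natCast_atTop_atTop
  have hcov : AECover (volume.restrict (Set.Ioi (0 : ℝ))) atTop
      (fun n : ℕ => Set.Ioo (R / ((n : ℝ) + 2)) ((n : ℝ) + 1 + R + |B|)) :=
    (aecover_Ioi_of_Ioi ha).inter (aecover_Iio hb)
  have hqm : Measurable q := by
    have h1 : Measurable fun r => ‖f r‖ := hfc.norm.measurable
    have h2 : Measurable fun r => ‖f r - (R / r) • f R‖ := by
      have : Continuous fun y : ℝ × ℝ => ‖f y.1 - y.2 • f R‖ := by fun_prop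
      exact this.measurable.comp (g := fun y : ℝ × ℝ => ‖f y.1 - y.2 • f R‖)
        (f := fun r => (r, R / r)) (by fun_prop)
    fun_prop
  refine le_of_tendsto (hcov.lintegral_tendsto_of_nat
    (f := fun r => ENNReal.ofReal (q r)) (by fun_prop)) (Eventually.of_forall fun n => ?_)
  refine le_trans (lintegral_mono' ?_ le_rfl) (key (R / ((n : ℝ) + 2)) ((n : ℝ) + 1 + R + |B|)
    (by positivity) ?_ ?_ ?_)
  · exact Measure.restrict_mono' (ae_of_all _ fun _ h => h) Measure.restrict_le_self
  · exact div_lt_self hR (by linarith [n.cast_nonneg (α := ℝ)])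
  · linarith [n.cast_nonneg (α := ℝ), abs_nonneg B]
  · linarith [n.cast_nonneg (α := ℝ), le_abs_self B]

/-- The partial derivative `∂ⱼf` of a real-valued function. -/
def realPartial (j : Fin 3) (f : E3 → ℝ) (x : E3) : ℝ :=
  fderiv ℝ f x (EuclideanSpace.single j 1)

/-- The Jacobian determinant `det (∇f, ∇g, ∇φ)`. -/
def jacobian (f g φ : E3 → ℝ) (x : E3) : ℝ :=
  ∑ k : Fin 3, (realPartial (k + 1) f x * realPartial (k + 2) g x -
    realPartial (k + 2) f x * realPartial (k + 1) g x) * realPartial k φ x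

theorem ContDiff.realPartial {f : E3 → ℝ} {n m : WithTop ℕ∞} (hf : ContDiff ℝ n f)
    (hmn : m + 1 ≤ n) (j : Fin 3) : ContDiff ℝ m (realPartial j f) :=
  (hf.fderiv_right hmn).clm_apply contDiff_const

theorem HasCompactSupport.realPartial {f : E3 → ℝ} (hf : HasCompactSupport f) (j : Fin 3) :
    HasCompactSupport (realPartial j f) :=
  hf.fderiv_apply (𝕜 := ℝ) _

theorem realPartial_comm {f : E3 → ℝ} (hf : ContDiff ℝ 2 f) (i j : Fin 3) (x : E3) :
    realPartial i (realPartial j f) x = realPartial j (realPartial i f) x := by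
  have hd : DifferentiableAt ℝ (fderiv ℝ f) x :=
    ((hf.fderiv_right (m := 1) (by norm_num)).differentiable one_ne_zero) x
  have key : ∀ i j : Fin 3, realPartial i (realPartial j f) x =
      fderiv ℝ (fderiv ℝ f) x (EuclideanSpace.single i 1) (EuclideanSpace.single j 1) := by
    intro i j
    unfold realPartial
    rw [fderiv_clm_apply hd (differentiableAt_const _)]
    simp
  rw [key, key]
  exact (hf.contDiffAt.isSymmSndFDerivAt (by simp)).eq _ _

theorem realPartial_mul {f g : E3 → ℝ} {x : E3} (hf : DifferentiableAt ℝ f x)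
    (hg : DifferentiableAt ℝ g x) (j : Fin 3) :
    realPartial j (fun y => f y * g y) x = f x * realPartial j g x + realPartial j f x * g x := by
  unfold realPartial
  rw [fderiv_fun_mul hf hg]
  simp [mul_comm]

theorem realPartial_sub {f g : E3 → ℝ} {x : E3} (hf : DifferentiableAt ℝ f x)
    (hg : DifferentiableAt ℝ g x) (j : Fin 3) :
    realPartial j (fun y => f y - g y) x = realPartial j f x - realPartial j g x := by
  unfold realPartial
  rw [fderiv_fun_sub hf hg]
  simp

section Jacobian

variable {f g φ : E3 → ℝ}

theorem integrable_jacobian (hf : ContDiff ℝ 2 f) (hg : ContDiff ℝ 2 g)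
    (hfs : HasCompactSupport f) (hφ' : ∀ k, Continuous (realPartial k φ)) :
    Integrable (jacobian f g φ) := by
  have hf1 := fun j => (hf.realPartial (m := 1) (by norm_num) j).continuous
  have hg1 := fun j => (hg.realPartial (m := 1) (by norm_num) j).continuous
  refine integrable_finsetSum _ fun k _ => Continuous.integrable_of_hasCompactSupport ?_ ?_
  · exact (((hf1 _).mul (hg1 _)).sub ((hf1 _).mul (hg1 _))).mul (hφ' k)
  · exact HasCompactSupport.mul_right (((hfs.realPartial _).mul_right).sub
      ((hfs.realPartial _).mul_right))

/-- The Jacobian determinant is a null Lagrangian. -/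
theorem integral_jacobian_eq_zero (hf : ContDiff ℝ 2 f) (hg : ContDiff ℝ 2 g)
    (hfs : HasCompactSupport f) (hφ : Differentiable ℝ φ)
    (hφ' : ∀ k, Continuous (realPartial k φ)) : ∫ x, jacobian f g φ x = 0 := by
  have hf1 := fun j => hf.realPartial (m := 1) (by norm_num) j
  have hg1 := fun j => hg.realPartial (m := 1) (by norm_num) j
  have hf1d := fun j => (hf1 j).differentiable one_ne_zero
  have hg1d := fun j => (hg1 j).differentiable one_ne_zero
  set V : Fin 3 → E3 → ℝ := fun k x => realPartial (k + 1) f x * realPartial (k + 2) g x -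
    realPartial (k + 2) f x * realPartial (k + 1) g x with hV
  have hVc : ∀ k, ContDiff ℝ 1 (V k) := fun k =>
    ((hf1 _).mul (hg1 _)).sub ((hf1 _).mul (hg1 _))
  have hVs : ∀ k, HasCompactSupport (V k) := fun k =>
    ((hfs.realPartial _).mul_right).sub ((hfs.realPartial _).mul_right)
  have hi1 : ∀ k, Integrable (fun x => realPartial k (V k) x * φ x) := fun k =>
    (((hVc k).realPartial (m := 0) (by norm_num) k).continuous.mul
      hφ.continuous).integrable_of_hasCompactSupport ((hVs k).realPartial k).mul_right
  have hi2 : ∀ k, Integrable (fun x => V k x * realPartial k φ x) := fun k =>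
    ((hVc k).continuous.mul (hφ' k)).integrable_of_hasCompactSupport (hVs k).mul_right
  have hi3 : ∀ k, Integrable (fun x => V k x * φ x) := fun k =>
    ((hVc k).continuous.mul hφ.continuous).integrable_of_hasCompactSupport (hVs k).mul_right
  have hibp : ∀ k, ∫ x, V k x * realPartial k φ x = -∫ x, realPartial k (V k) x * φ x := fun k =>
    integral_mul_fderiv_eq_neg_fderiv_mul_of_integrable (hi1 k) (hi2 k) (hi3 k)
      (fun x _ => (hVc k).differentiable one_ne_zero x) (fun x _ => hφ x)
  have hdiv : ∀ x, ∑ k, realPartial k (V k) x * φ x = 0 := by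
    intro x
    have hk : ∀ k, realPartial k (V k) x = _ := fun k =>
      (realPartial_sub (((hf1d (k + 1)).mul (hg1d (k + 2))) x)
        (((hf1d (k + 2)).mul (hg1d (k + 1))) x) k).trans
      (congrArg₂ (· - ·) (realPartial_mul (hf1d (k + 1) x) (hg1d (k + 2) x) k)
        (realPartial_mul (hf1d (k + 2) x) (hg1d (k + 1) x) k))
    have e1 : (1 : Fin 3) + 1 = 2 := rfl
    have e2 : (1 : Fin 3) + 2 = 0 := rfl
    have e3 : (2 : Fin 3) + 1 = 0 := rfl
    have e4 : (2 : Fin 3) + 2 = 1 := rfl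
    simp only [Fin.sum_univ_three, hk, zero_add, e1, e2, e3, e4]
    rw [realPartial_comm hf 1 0, realPartial_comm hf 2 0, realPartial_comm hf 2 1,
      realPartial_comm hg 1 0, realPartial_comm hg 2 0, realPartial_comm hg 2 1]
    ring
  calc ∫ x, jacobian f g φ x = ∑ k, ∫ x, V k x * realPartial k φ x :=
        integral_finsetSum _ fun k _ => hi2 k
    _ = -∫ x, ∑ k, realPartial k (V k) x * φ x := by
        rw [integral_finsetSum _ fun k _ => hi1 k, ← Finset.sum_neg_distrib]
        exact Finset.sum_congr rfl fun k _ => hibp k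
    _ = 0 := by simp [hdiv]

end Jacobian

/-- The function `x ↦ xₐ |x|`. -/
def coordMulNorm (a : Fin 3) (x : E3) : ℝ := x a * ‖x‖

theorem hasFDerivAt_coordMulNorm (a : Fin 3) (x : E3) :
    HasFDerivAt (coordMulNorm a)
      (‖x‖ • (EuclideanSpace.proj a : E3 →L[ℝ] ℝ) + (x a / ‖x‖) • innerSL ℝ x) x := by
  by_cases hx : x = 0
  · subst hx
    rw [hasFDerivAt_iff_isLittleO_nhds_zero]
    simp only [coordMulNorm, zero_add, PiLp.zero_apply, norm_zero, zero_mul, zero_smul, zero_div,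
      add_zero, sub_zero, zero_apply]
    refine Asymptotics.isLittleO_iff.2 fun c hc => ?_
    filter_upwards [Metric.ball_mem_nhds (0 : E3) hc] with y hy
    rw [mem_ball_zero_iff] at hy
    rw [norm_mul, norm_norm]
    gcongr
    exact (PiLp.norm_apply_le y a).trans hy.le
  · have h1 : HasFDerivAt (fun y : E3 => y a) (EuclideanSpace.proj a : E3 →L[ℝ] ℝ) x :=
      (EuclideanSpace.proj a : E3 →L[ℝ] ℝ).hasFDerivAt
    have h2 : HasFDerivAt (fun y : E3 => ‖y‖) (‖x‖⁻¹ • innerSL ℝ x) x := by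
      have h := (hasStrictFDerivAt_norm_sq x).hasFDerivAt.sqrt (by simpa using hx)
      simp only [Real.sqrt_sq (norm_nonneg _)] at h
      refine h.congr_fderiv ?_
      ext y
      simp
      field_simp
    refine (h1.mul h2).congr_fderiv ?_
    ext y
    simp [div_eq_mul_inv]
    ring

theorem realPartial_coordMulNorm (a k : Fin 3) (x : E3) :
    realPartial k (coordMulNorm a) x = (if a = k then ‖x‖ else 0) + x a * x k / ‖x‖ := by
  rw [realPartial, (hasFDerivAt_coordMulNorm a x).fderiv]
  simp [EuclideanSpace.inner_single_right]
  ring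

theorem continuous_realPartial_coordMulNorm (a k : Fin 3) :
    Continuous (realPartial k (coordMulNorm a)) := by
  rw [funext (realPartial_coordMulNorm a k)]
  have h1 : Continuous fun x : E3 => x a * x k / ‖x‖ := by
    rw [continuous_iff_continuousAt]
    intro x
    by_cases hx : x = 0
    · subst hx
      have : Tendsto (fun x : E3 => ‖x‖) (nhds 0) (nhds 0) := by
        simpa using (continuous_norm (E := E3)).tendsto 0
      simp only [ContinuousAt, PiLp.zero_apply, zero_mul, zero_div]
      refine squeeze_zero_norm (fun y => ?_) this
      rw [norm_div, norm_mul, norm_norm]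
      refine div_le_of_le_mul₀ (norm_nonneg _) (norm_nonneg _) ?_
      exact mul_le_mul (PiLp.norm_apply_le y a) (PiLp.norm_apply_le y k) (norm_nonneg _)
        (norm_nonneg _)
    · have : ‖x‖ ≠ 0 := norm_ne_zero_iff.2 hx
      fun_prop (disch := assumption)
  split_ifs <;> fun_prop

/-- For two-component spinors with gradient `a + i b, c + i d`, the identity
`r² (r² |σ·∇|² - |x·∇|² - null Lagrangian) = ½ Σⱼ |(σ·x) Tⱼ + i (x × T)ⱼ|²`, `T = x × ∇`,
written as an inequality. -/
theorem spinor_gradient_bound (x a b c d : Fin 3 → ℝ) {s : ℝ}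
    (hs : s = x 0 ^ 2 + x 1 ^ 2 + x 2 ^ 2) (hpos : 0 < s) :
    (x 0 * a 0 + x 1 * a 1 + x 2 * a 2) ^ 2 + (x 0 * b 0 + x 1 * b 1 + x 2 * b 2) ^ 2 +
      (x 0 * c 0 + x 1 * c 1 + x 2 * c 2) ^ 2 + (x 0 * d 0 + x 1 * d 1 + x 2 * d 2) ^ 2 +
      2 * (((b 1 * c 2 - b 2 * c 1 - (a 1 * d 2 - a 2 * d 1)) * (s + x 0 * x 0) +
          (b 2 * c 0 - b 0 * c 2 - (a 2 * d 0 - a 0 * d 2)) * (x 0 * x 1) +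
          (b 0 * c 1 - b 1 * c 0 - (a 0 * d 1 - a 1 * d 0)) * (x 0 * x 2)) +
        ((a 1 * c 2 - a 2 * c 1 + (b 1 * d 2 - b 2 * d 1)) * (x 1 * x 0) +
          (a 2 * c 0 - a 0 * c 2 + (b 2 * d 0 - b 0 * d 2)) * (s + x 1 * x 1) +
          (a 0 * c 1 - a 1 * c 0 + (b 0 * d 1 - b 1 * d 0)) * (x 1 * x 2)) +
        ((c 1 * d 2 - c 2 * d 1 - (a 1 * b 2 - a 2 * b 1)) * (x 2 * x 0) +
          (c 2 * d 0 - c 0 * d 2 - (a 2 * b 0 - a 0 * b 2)) * (x 2 * x 1) +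
          (c 0 * d 1 - c 1 * d 0 - (a 0 * b 1 - a 1 * b 0)) * (s + x 2 * x 2))) ≤
      s * ((a 2 + c 0 + d 1) ^ 2 + (b 2 + d 0 - c 1) ^ 2 + (a 0 - b 1 - c 2) ^ 2 +
        (b 0 + a 1 - d 2) ^ 2) := by
  set T : (Fin 3 → ℝ) → Fin 3 → ℝ := fun u j => x (j + 1) * u (j + 2) - x (j + 2) * u (j + 1)
    with hT
  set Z : ℝ := ∑ j, ((x 2 * T a j + x 0 * T c j + x 1 * T d j - T (T b) j) ^ 2 +
    (x 2 * T b j + x 0 * T d j - x 1 * T c j + T (T a) j) ^ 2 +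
    (x 0 * T a j - x 1 * T b j - x 2 * T c j - T (T d) j) ^ 2 +
    (x 0 * T b j + x 1 * T a j - x 2 * T d j + T (T c) j) ^ 2) with hZ
  have hZ0 : 0 ≤ Z := Finset.sum_nonneg fun j _ => by positivity
  have e1 : (1 : Fin 3) + 1 = 2 := rfl
  have e2 : (1 : Fin 3) + 2 = 0 := rfl
  have e3 : (2 : Fin 3) + 1 = 0 := rfl
  have e4 : (2 : Fin 3) + 2 = 1 := rfl
  simp only [hT, Fin.sum_univ_three, zero_add, e1, e2, e3, e4] at hZ
  rw [← sub_nonneg]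
  refine nonneg_of_mul_nonneg_right (a := s) (le_of_le_of_eq (div_nonneg hZ0 zero_le_two) ?_) hpos
  rw [hZ, hs]
  ring

theorem mulVecE_diracAlpha_zero (v : C4) : mulVecE (diracAlpha 0) v = !₂[v 3, v 2, v 1, v 0] := by
  ext i
  fin_cases i <;>
    simp [mulVecE, diracAlpha, pauli, Matrix.toLpLin_apply, Matrix.mulVec, dotProduct,
      Fin.sum_univ_four, Matrix.reindex_apply, Matrix.fromBlocks, finSumFinEquiv, Fin.addCases]

theorem mulVecE_diracAlpha_one (v : C4) : mulVecE (diracAlpha 1) v =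
    !₂[-Complex.I * v 3, Complex.I * v 2, -Complex.I * v 1, Complex.I * v 0] := by
  ext i
  fin_cases i <;>
    simp [mulVecE, diracAlpha, pauli, Matrix.toLpLin_apply, Matrix.mulVec, dotProduct,
      Fin.sum_univ_four, Matrix.reindex_apply, Matrix.fromBlocks, finSumFinEquiv, Fin.addCases]

theorem mulVecE_diracAlpha_two (v : C4) :
    mulVecE (diracAlpha 2) v = !₂[v 2, -v 3, v 0, -v 1] := by
  ext i
  fin_cases i <;>
    simp [mulVecE, diracAlpha, pauli, Matrix.toLpLin_apply, Matrix.mulVec, dotProduct,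
      Fin.sum_univ_four, Matrix.reindex_apply, Matrix.fromBlocks, finSumFinEquiv, Fin.addCases]

/-- The real part of a component of a spinor field. -/
def compRe (ψ : E3 → C4) (i : Fin 4) (x : E3) : ℝ := (ψ x i).re

/-- The imaginary part of a component of a spinor field. -/
def compIm (ψ : E3 → C4) (i : Fin 4) (x : E3) : ℝ := (ψ x i).im

theorem contDiff_compRe {ψ : E3 → C4} {n : WithTop ℕ∞} (hψ : ContDiff ℝ n ψ) (i : Fin 4) :
    ContDiff ℝ n (compRe ψ i) :=
  (Complex.reCLM.comp (PiLp.proj (𝕜 := ℝ) 2 (fun _ : Fin 4 => ℂ) i)).contDiff.comp hψ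

theorem contDiff_compIm {ψ : E3 → C4} {n : WithTop ℕ∞} (hψ : ContDiff ℝ n ψ) (i : Fin 4) :
    ContDiff ℝ n (compIm ψ i) :=
  (Complex.imCLM.comp (PiLp.proj (𝕜 := ℝ) 2 (fun _ : Fin 4 => ℂ) i)).contDiff.comp hψ

theorem hasCompactSupport_compRe {ψ : E3 → C4} (hψ : HasCompactSupport ψ) (i : Fin 4) :
    HasCompactSupport (compRe ψ i) :=
  hψ.comp_left (g := fun v : C4 => (v i).re) (by simp)

theorem hasCompactSupport_compIm {ψ : E3 → C4} (hψ : HasCompactSupport ψ) (i : Fin 4) :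
    HasCompactSupport (compIm ψ i) :=
  hψ.comp_left (g := fun v : C4 => (v i).im) (by simp)

theorem realPartial_compRe {ψ : E3 → C4} {x : E3} (hψ : DifferentiableAt ℝ ψ x) (i : Fin 4)
    (j : Fin 3) : realPartial j (compRe ψ i) x = (pderiv3 j ψ x i).re := by
  have := ((Complex.reCLM.comp
    (PiLp.proj (𝕜 := ℝ) 2 (fun _ : Fin 4 => ℂ) i)).hasFDerivAt.comp x
      hψ.hasFDerivAt).fderiv
  exact congrArg (fun L : E3 →L[ℝ] ℝ => L (EuclideanSpace.single j 1)) this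

theorem realPartial_compIm {ψ : E3 → C4} {x : E3} (hψ : DifferentiableAt ℝ ψ x) (i : Fin 4)
    (j : Fin 3) : realPartial j (compIm ψ i) x = (pderiv3 j ψ x i).im := by
  have := ((Complex.imCLM.comp
    (PiLp.proj (𝕜 := ℝ) 2 (fun _ : Fin 4 => ℂ) i)).hasFDerivAt.comp x
      hψ.hasFDerivAt).fderiv
  exact congrArg (fun L : E3 →L[ℝ] ℝ => L (EuclideanSpace.single j 1)) this

/-- The combination of Jacobian determinants relating the Dirac operator and the radial derivative
on the two-component spinor `(a + i b, c + i d)`. -/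
def spinorNull (a b c d : E3 → ℝ) (x : E3) : ℝ :=
  2 * (jacobian b c (coordMulNorm 0) x - jacobian a d (coordMulNorm 0) x +
    jacobian a c (coordMulNorm 1) x + jacobian b d (coordMulNorm 1) x +
    jacobian c d (coordMulNorm 2) x - jacobian a b (coordMulNorm 2) x)

theorem differentiable_coordMulNorm (a : Fin 3) : Differentiable ℝ (coordMulNorm a) :=
  fun x => (hasFDerivAt_coordMulNorm a x).differentiableAt

theorem integral_spinorNull {a b c d : E3 → ℝ} (ha : ContDiff ℝ 2 a) (hb : ContDiff ℝ 2 b)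
    (hc : ContDiff ℝ 2 c) (hd : ContDiff ℝ 2 d) (has : HasCompactSupport a)
    (hbs : HasCompactSupport b) (hcs : HasCompactSupport c) :
    Integrable (spinorNull a b c d) ∧ ∫ x, spinorNull a b c d x = 0 := by
  have hi : ∀ {f g : E3 → ℝ} (k : Fin 3), ContDiff ℝ 2 f → ContDiff ℝ 2 g →
      HasCompactSupport f → Integrable (jacobian f g (coordMulNorm k)) := fun k hf hg hfs =>
    integrable_jacobian hf hg hfs (continuous_realPartial_coordMulNorm k)
  have hz : ∀ {f g : E3 → ℝ} (k : Fin 3), ContDiff ℝ 2 f → ContDiff ℝ 2 g →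
      HasCompactSupport f → ∫ x, jacobian f g (coordMulNorm k) x = 0 := fun k hf hg hfs =>
    integral_jacobian_eq_zero hf hg hfs (differentiable_coordMulNorm k)
      (continuous_realPartial_coordMulNorm k)
  have h1 := (hi 0 hb hc hbs).sub (hi 0 ha hd has)
  have h2 := h1.add (hi 1 ha hc has)
  have h3 := h2.add (hi 1 hb hd hbs)
  have h4 := h3.add (hi 2 hc hd hcs)
  have h5 := h4.sub (hi 2 ha hb has)
  refine ⟨h5.const_mul 2, ?_⟩
  have e5 := integral_sub' h4 (hi 2 ha hb has)
  have e4 := integral_add' h3 (hi 2 hc hd hcs)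
  have e3 := integral_add' h2 (hi 1 hb hd hbs)
  have e2 := integral_add' h1 (hi 1 ha hc has)
  have e1 := integral_sub' (hi 0 hb hc hbs) (hi 0 ha hd has)
  rw [hz 0 hb hc hbs, hz 0 ha hd has] at e1
  rw [e1, hz 1 ha hc has] at e2
  rw [e2, hz 1 hb hd hbs] at e3
  rw [e3, hz 2 hc hd hcs] at e4
  rw [e4, hz 2 ha hb has] at e5
  have : ∫ x, spinorNull a b c d x = 2 * _ := integral_const_mul 2 _
  rw [this]
  refine (congrArg (2 * ·) e5).trans ?_
  norm_num

theorem spinorNull_bound (a b c d : E3 → ℝ) (x : E3) :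
    ‖x‖ * ((∑ j, x j / ‖x‖ * realPartial j a x) ^ 2 + (∑ j, x j / ‖x‖ * realPartial j b x) ^ 2 +
      (∑ j, x j / ‖x‖ * realPartial j c x) ^ 2 + (∑ j, x j / ‖x‖ * realPartial j d x) ^ 2) +
      spinorNull a b c d x ≤
    ‖x‖ * ((realPartial 2 a x + realPartial 0 c x + realPartial 1 d x) ^ 2 +
      (realPartial 2 b x + realPartial 0 d x - realPartial 1 c x) ^ 2 +
      (realPartial 0 a x - realPartial 1 b x - realPartial 2 c x) ^ 2 +
      (realPartial 0 b x + realPartial 1 a x - realPartial 2 d x) ^ 2) := by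
  by_cases hx : x = 0
  · subst hx
    simp [spinorNull, jacobian, realPartial_coordMulNorm]
  have hr : 0 < ‖x‖ := norm_pos_iff.2 hx
  have hs : ‖x‖ ^ 2 = x 0 ^ 2 + x 1 ^ 2 + x 2 ^ 2 := by
    simp [EuclideanSpace.norm_sq_eq, Fin.sum_univ_three]
  have h := spinor_gradient_bound (fun j => x j) (fun j => realPartial j a x)
    (fun j => realPartial j b x) (fun j => realPartial j c x) (fun j => realPartial j d x) hs
    (by positivity)
  refine le_of_mul_le_mul_left (le_of_eq_of_le ?_ (h.trans_eq ?_)) hr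
  · have e1 : (1 : Fin 3) + 1 = 2 := rfl
    have e2 : (1 : Fin 3) + 2 = 0 := rfl
    have e3 : (2 : Fin 3) + 1 = 0 := rfl
    have e4 : (2 : Fin 3) + 2 = 1 := rfl
    simp only [spinorNull, jacobian, realPartial_coordMulNorm, Fin.sum_univ_three, zero_add, e1,
      e2, e3, e4, if_true, reduceIte, Fin.reduceEq]
    field_simp
    ring
  · ring

theorem norm_sq_diracD {ψ : E3 → C4} {x : E3} (hψ : DifferentiableAt ℝ ψ x) :
    ‖diracD ψ x‖ ^ 2 =
      ((realPartial 2 (compRe ψ 0) x + realPartial 0 (compRe ψ 1) x +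
          realPartial 1 (compIm ψ 1) x) ^ 2 +
        (realPartial 2 (compIm ψ 0) x + realPartial 0 (compIm ψ 1) x -
          realPartial 1 (compRe ψ 1) x) ^ 2 +
        (realPartial 0 (compRe ψ 0) x - realPartial 1 (compIm ψ 0) x -
          realPartial 2 (compRe ψ 1) x) ^ 2 +
        (realPartial 0 (compIm ψ 0) x + realPartial 1 (compRe ψ 0) x -
          realPartial 2 (compIm ψ 1) x) ^ 2) +
      ((realPartial 2 (compRe ψ 2) x + realPartial 0 (compRe ψ 3) x +
          realPartial 1 (compIm ψ 3) x) ^ 2 +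
        (realPartial 2 (compIm ψ 2) x + realPartial 0 (compIm ψ 3) x -
          realPartial 1 (compRe ψ 3) x) ^ 2 +
        (realPartial 0 (compRe ψ 2) x - realPartial 1 (compIm ψ 2) x -
          realPartial 2 (compRe ψ 3) x) ^ 2 +
        (realPartial 0 (compIm ψ 2) x + realPartial 1 (compRe ψ 2) x -
          realPartial 2 (compIm ψ 3) x) ^ 2) := by
  rw [diracD, norm_smul, norm_neg, Complex.norm_I, one_mul, EuclideanSpace.norm_sq_eq,
    Fin.sum_univ_four]
  simp only [Fin.sum_univ_three, mulVecE_diracAlpha_zero, mulVecE_diracAlpha_one,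
    mulVecE_diracAlpha_two, realPartial_compRe hψ, realPartial_compIm hψ, PiLp.add_apply,
    Complex.sq_norm, Complex.normSq_apply]
  simp
  ring

theorem norm_sq_radialDeriv {ψ : E3 → C4} {x : E3} (hψ : DifferentiableAt ℝ ψ x) :
    ‖radialDeriv ψ x‖ ^ 2 =
      ∑ i, ((∑ j, x j / ‖x‖ * realPartial j (compRe ψ i) x) ^ 2 +
        (∑ j, x j / ‖x‖ * realPartial j (compIm ψ i) x) ^ 2) := by
  rw [radialDeriv, EuclideanSpace.norm_sq_eq]
  refine Finset.sum_congr rfl fun i _ => ?_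
  simp only [Fin.sum_univ_three, realPartial_compRe hψ, realPartial_compIm hψ, PiLp.add_apply,
    PiLp.smul_apply, Complex.sq_norm, Complex.normSq_apply, Complex.add_re, Complex.add_im,
    Complex.real_smul, Complex.re_ofReal_mul, Complex.im_ofReal_mul]
  ring

theorem continuous_diracD {ψ : E3 → C4} (hψ : ContDiff ℝ 1 ψ) : Continuous (diracD ψ) := by
  have hL : ∀ j, Continuous (mulVecE (diracAlpha j)) := fun j =>
    LinearMap.continuous_of_finiteDimensional (Matrix.toEuclideanLin (diracAlpha j))
  have hp : ∀ j, Continuous (pderiv3 j ψ) := fun j =>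
    (hψ.continuous_fderiv one_ne_zero).clm_apply continuous_const
  have hsum : Continuous fun x => ∑ j : Fin 3, mulVecE (diracAlpha j) (pderiv3 j ψ x) :=
    continuous_finsetSum _ fun j _ => (hL j).comp (hp j)
  exact hsum.const_smul (-Complex.I)

theorem hasCompactSupport_diracD {ψ : E3 → C4} (hψ : HasCompactSupport ψ) :
    HasCompactSupport (diracD ψ) := by
  refine (hψ.fderiv (𝕜 := ℝ)).comp_left (g := fun L : E3 →L[ℝ] C4 =>
    (-Complex.I) • ∑ j : Fin 3, mulVecE (diracAlpha j) (L (EuclideanSpace.single j 1))) ?_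
  simp [mulVecE]

theorem integrable_norm_mul_norm_sq_diracD {ψ : E3 → C4} (hψ : ContDiff ℝ 1 ψ)
    (hs : HasCompactSupport ψ) : Integrable fun x : E3 => ‖x‖ * ‖diracD ψ x‖ ^ 2 := by
  have := continuous_diracD hψ
  refine Continuous.integrable_of_hasCompactSupport (by fun_prop) (HasCompactSupport.mul_left ?_)
  exact (hasCompactSupport_diracD hs).comp_left (g := fun v : C4 => ‖v‖ ^ 2) (by simp)

/-- The Dirac operator dominates the radial derivative in the space weighted by `|x|`. -/
theorem lintegral_radialDeriv_le {ψ : E3 → C4} (hψ : ContDiff ℝ 2 ψ) (hs : HasCompactSupport ψ) :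
    ∫⁻ x : E3, ENNReal.ofReal (‖x‖ * ‖radialDeriv ψ x‖ ^ 2) ≤
      ENNReal.ofReal (∫ x : E3, ‖x‖ * ‖diracD ψ x‖ ^ 2) := by
  have hre := contDiff_compRe hψ
  have him := contDiff_compIm hψ
  have hres := hasCompactSupport_compRe hs
  have hims := hasCompactSupport_compIm hs
  obtain ⟨hi1, hz1⟩ := integral_spinorNull (hre 0) (him 0) (hre 1) (him 1) (hres 0) (hims 0)
    (hres 1)
  obtain ⟨hi2, hz2⟩ := integral_spinorNull (hre 2) (him 2) (hre 3) (him 3) (hres 2) (hims 2)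
    (hres 3)
  have hi := integrable_norm_mul_norm_sq_diracD (hψ.of_le (by norm_num)) hs
  set N : E3 → ℝ := fun x => spinorNull (compRe ψ 0) (compIm ψ 0) (compRe ψ 1) (compIm ψ 1) x +
    spinorNull (compRe ψ 2) (compIm ψ 2) (compRe ψ 3) (compIm ψ 3) x with hN
  have hiN : Integrable N := hi1.add hi2
  have hzN : ∫ x, N x = 0 := by rw [hN, integral_add hi1 hi2, hz1, hz2, add_zero]
  have hpt : ∀ x : E3, ‖x‖ * ‖radialDeriv ψ x‖ ^ 2 ≤ ‖x‖ * ‖diracD ψ x‖ ^ 2 - N x := by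
    intro x
    have hd : DifferentiableAt ℝ ψ x := hψ.differentiable two_ne_zero x
    rw [norm_sq_diracD hd, norm_sq_radialDeriv hd, Fin.sum_univ_four]
    have h1 := spinorNull_bound (compRe ψ 0) (compIm ψ 0) (compRe ψ 1) (compIm ψ 1) x
    have h2 := spinorNull_bound (compRe ψ 2) (compIm ψ 2) (compRe ψ 3) (compIm ψ 3) x
    simp only [hN]
    linarith
  calc _ ≤ ∫⁻ x : E3, ENNReal.ofReal (‖x‖ * ‖diracD ψ x‖ ^ 2 - N x) :=
        lintegral_mono fun x => ENNReal.ofReal_le_ofReal (hpt x)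
    _ = ENNReal.ofReal (∫ x : E3, (‖x‖ * ‖diracD ψ x‖ ^ 2 - N x)) :=
        (ofReal_integral_eq_lintegral_ofReal (hi.sub hiN)
          (ae_of_all _ fun x => (by positivity : (0 : ℝ) ≤ _).trans (hpt x))).symm
    _ = _ := by rw [integral_sub hi hiN, hzN, sub_zero]

theorem radialDeriv_eq_fderiv (ψ : E3 → C4) (x : E3) :
    radialDeriv ψ x = fderiv ℝ ψ x (‖x‖⁻¹ • x) := by
  have hx : ‖x‖⁻¹ • x = ∑ j : Fin 3, (x j / ‖x‖) • EuclideanSpace.single j (1 : ℝ) := by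
    ext k
    simp [Finset.sum_apply, Pi.single_apply, div_eq_inv_mul]
  rw [hx, map_sum]
  simp [radialDeriv, pderiv3]

theorem measurable_norm_radialDeriv {ψ : E3 → C4} (hψ : ContDiff ℝ 1 ψ) :
    Measurable fun x => ‖radialDeriv ψ x‖ := by
  have hc : Continuous fun p : E3 × E3 => ‖fderiv ℝ ψ p.1 p.2‖ :=
    (((hψ.continuous_fderiv one_ne_zero).comp continuous_fst).clm_apply continuous_snd).norm
  simp only [radialDeriv_eq_fderiv]
  exact hc.measurable.comp (f := fun x : E3 => (x, ‖x‖⁻¹ • x)) (by fun_prop)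

theorem measurable_hardy_log_integrands {ψ : E3 → C4} (hψ : Continuous ψ) (R : ℝ) :
    Measurable (fun x : E3 => ‖ψ x‖ ^ 2 / ‖x‖) ∧
    Measurable (fun x : E3 => ‖ψ x - (R / ‖x‖) • ψ ((R / ‖x‖) • x)‖ ^ 2 /
          (‖x‖ * (Real.log (‖x‖ / R)) ^ 2)) := by
  have h1 : Measurable fun x => ‖ψ x‖ := hψ.norm.measurable
  have h2 : Measurable fun x : E3 => ‖ψ x - (R / ‖x‖) • ψ ((R / ‖x‖) • x)‖ := by
    have hc : Continuous fun p : E3 × ℝ => ‖ψ p.1 - p.2 • ψ (p.2 • p.1)‖ := by fun_prop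
    exact hc.measurable.comp (f := fun x : E3 => (x, R / ‖x‖)) (by fun_prop)
  constructor <;> fun_prop

/-- Radial Hardy inequality with logarithmic remainder on `ℝ³`. -/
theorem lintegral_hardy_log_le_radialDeriv {ψ : E3 → C4} (hψ : ContDiff ℝ 1 ψ)
    (hs : HasCompactSupport ψ) {R : ℝ} (hR : 0 < R) :
    ∫⁻ x : E3, ENNReal.ofReal (‖ψ x‖ ^ 2 / ‖x‖ +
        1 / 4 * (‖ψ x - (R / ‖x‖) • ψ ((R / ‖x‖) • x)‖ ^ 2 /
          (‖x‖ * (Real.log (‖x‖ / R)) ^ 2))) ≤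
      ∫⁻ x : E3, ENNReal.ofReal (‖x‖ * ‖radialDeriv ψ x‖ ^ 2) := by
  obtain ⟨hm1, hm2⟩ := measurable_hardy_log_integrands hψ.continuous R
  have hm3 := measurable_norm_radialDeriv hψ
  have hdim : Module.finrank ℝ E3 - 1 = 2 := by simp
  rw [lintegral_polar volume (by fun_prop), lintegral_polar volume (by fun_prop), hdim]
  refine lintegral_mono fun ω => ?_
  have hω : ‖(ω : E3)‖ = 1 := by simp
  set f : ℝ → C4 := fun r => ψ (r • (ω : E3)) with hf
  have hfc : ContDiff ℝ 1 f := hψ.comp (by fun_prop)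
  obtain ⟨B, hB⟩ := hs.isCompact.isBounded.subset_closedBall (0 : E3)
  have hfB : ∀ r, |B| + 1 ≤ r → f r = 0 := fun r hr => by
    change ψ (r • (ω : E3)) = 0
    refine image_eq_zero_of_notMem_tsupport fun hmem => ?_
    have := hB hmem
    rw [mem_closedBall_zero_iff, norm_smul, hω, mul_one] at this
    linarith [le_abs_self B, le_abs_self r, Real.norm_eq_abs r]
  have hfd : ∀ r, 0 < r → deriv f r = radialDeriv ψ (r • (ω : E3)) := fun r hr => by
    have h1 : HasDerivAt (fun r : ℝ => r • (ω : E3)) ((1 : ℝ) • (ω : E3)) r :=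
      (hasDerivAt_id' r).smul_const _
    have h2 := ((hψ.differentiable one_ne_zero (r • (ω : E3))).hasFDerivAt.comp_hasDerivAt r h1)
    rw [radialDeriv_eq_fderiv, norm_smul, hω, mul_one, Real.norm_of_nonneg hr.le, smul_smul,
      inv_mul_cancel₀ hr.ne']
    exact h2.deriv
  refine le_of_eq_of_le ?_ ((lintegral_ray_hardy_log hfc hfB hR).trans_eq ?_)
  · refine setLIntegral_congr_fun measurableSet_Ioi fun r (hr : 0 < r) => ?_
    have hr0 : r ≠ 0 := hr.ne'
    simp only [norm_smul, hω, mul_one, Real.norm_of_nonneg hr.le, smul_smul,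
      div_mul_cancel₀ _ hr0]
    rw [← ENNReal.ofReal_mul (by positivity)]
    congr 1
    simp only [hf]
    by_cases hl : Real.log (r / R) = 0
    · simp only [hl, ne_eq, OfNat.ofNat_ne_zero, not_false_eq_true, zero_pow, mul_zero, div_zero,
        add_zero]
      field_simp
    · field_simp
  · refine setLIntegral_congr_fun measurableSet_Ioi fun r (hr : 0 < r) => ?_
    simp only [hfd r hr, norm_smul, hω, mul_one, Real.norm_of_nonneg hr.le]
    rw [← ENNReal.ofReal_mul (by positivity)]
    congr 1
    ring

/-- Hardy–Dirac inequality with logarithmic remainder. -/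
theorem hardy_dirac_log_remainder (ψ : E3 → C4) (hsmooth : ContDiff ℝ (⊤ : ℕ∞) ψ)
    (hsupp : HasCompactSupport ψ) (R : ℝ) (hR : 0 < R) :
    (∫ x : E3, ‖x‖ * ‖diracD ψ x‖ ^ 2) ≥
      (∫ x : E3, ‖ψ x‖ ^ 2 / ‖x‖) +
        (1 / 4) * ∫ x : E3, ‖ψ x - (R / ‖x‖) • ψ ((R / ‖x‖) • x)‖ ^ 2 /
          (‖x‖ * (Real.log (‖x‖ / R)) ^ 2) := by
  have h2 : ContDiff ℝ 2 ψ := by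
    exact_mod_cast contDiff_infty.1 hsmooth 2
  have h1 : ContDiff ℝ 1 ψ := h2.of_le (by norm_num)
  obtain ⟨hm1, hm2⟩ := measurable_hardy_log_integrands h1.continuous R
  have hle := (lintegral_hardy_log_le_radialDeriv h1 hsupp hR).trans
    (lintegral_radialDeriv_le h2 hsupp)
  set P : E3 → ℝ := fun x => ‖ψ x‖ ^ 2 / ‖x‖
  set Q : E3 → ℝ := fun x => ‖ψ x - (R / ‖x‖) • ψ ((R / ‖x‖) • x)‖ ^ 2 /
    (‖x‖ * (Real.log (‖x‖ / R)) ^ 2)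
  have hP0 : ∀ x, 0 ≤ P x := fun x => by positivity
  have hQ0 : ∀ x, 0 ≤ 1 / 4 * Q x := fun x => by positivity
  have hPQ : Integrable fun x => P x + 1 / 4 * Q x := by
    refine ⟨by fun_prop, ?_⟩
    rw [hasFiniteIntegral_iff_ofReal (ae_of_all _ fun x => add_nonneg (hP0 x) (hQ0 x))]
    exact hle.trans_lt ENNReal.ofReal_lt_top
  have hPi : Integrable P := hPQ.mono' (by fun_prop) (ae_of_all _ fun x => by
    rw [Real.norm_of_nonneg (hP0 x)]
    linarith [hQ0 x])
  have hQi : Integrable fun x => 1 / 4 * Q x := hPQ.mono' (by fun_prop) (ae_of_all _ fun x => by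
    rw [Real.norm_of_nonneg (hQ0 x)]
    linarith [hP0 x])
  rw [← ofReal_integral_eq_lintegral_ofReal hPQ
    (ae_of_all _ fun x => add_nonneg (hP0 x) (hQ0 x))] at hle
  have hD0 : 0 ≤ ∫ x : E3, ‖x‖ * ‖diracD ψ x‖ ^ 2 := integral_nonneg fun x => by positivity
  have := (ENNReal.ofReal_le_ofReal_iff hD0).1 hle
  rwa [integral_add hPi hQi, integral_const_mul] at this
end
end

section
/- The constant 1/4 in the Hardy–Dirac inequality with logarithmic remainder is sharp: for every c > 1/4 there exist R > 0 and a nonzero ψ ∈ C_c^∞(ℝ³;ℂ⁴) such that ∫_{ℝ³} |x| |(−iα·∇ψ)(x)|² dx < ∫_{ℝ³} |ψ(x)|²/|x| dx + c ∫_{ℝ³} |ψ(x) − (R/|x|) ψ(R x/|x|)|² / (|x| (log(|x|/R))²) dx. -/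
open MeasureTheory Real Filter

noncomputable section

/-- There are test functions on the line whose Dirichlet energy is arbitrarily small compared with
their `L²` norm. -/
lemma exists_testFunction_energy_lt {δ : ℝ} (hδ : 0 < δ) :
    ∃ φ : ℝ → ℝ, ContDiff ℝ (⊤ : ℕ∞) φ ∧ HasCompactSupport φ ∧ φ 0 ≠ 0 ∧
      ∫ s, deriv φ s ^ 2 < δ * ∫ s, φ s ^ 2 := by
  let b : ContDiffBump (0 : ℝ) := ⟨1, 2, one_pos, one_lt_two⟩
  have hb : ContDiff ℝ (⊤ : ℕ∞) b := b.contDiff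
  have hb0 : b 0 = 1 := b.one_of_mem_closedBall (by simp [b.rIn_pos.le])
  set A := ∫ s, deriv b s ^ 2
  set B := ∫ s, b s ^ 2
  have hB : 0 < B := by
    refine Continuous.integral_pos_of_hasCompactSupport_nonneg_nonzero (x := 0)
      (hb.continuous.pow 2) ?_ (fun s => sq_nonneg _) (by simp [hb0])
    exact b.hasCompactSupport.comp_left (g := fun y => y ^ 2) (by simp)
  have hA : 0 ≤ A := integral_nonneg fun s => sq_nonneg _
  obtain ⟨ε, hε, hεA⟩ : ∃ ε : ℝ, 0 < ε ∧ ε ^ 2 * A < δ * B := by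
    refine ⟨√(δ * B / (A + 1)), by positivity, ?_⟩
    rw [Real.sq_sqrt (by positivity), div_mul_eq_mul_div, div_lt_iff₀ (by positivity)]
    have : 0 < δ * B := by positivity
    nlinarith
  have hderiv : ∀ s, deriv (fun s => b (ε * s)) s = ε * deriv b (ε * s) := fun s => by
    simpa using deriv_comp_mul_left ε b s
  refine ⟨fun s => b (ε * s), hb.comp (contDiff_const.mul contDiff_id), ?_, by simp [hb0], ?_⟩
  · exact b.hasCompactSupport.comp_homeomorph (Homeomorph.mulLeft₀ ε hε.ne')
  · simp only [hderiv, mul_pow]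
    rw [integral_const_mul, Measure.integral_comp_mul_left (fun s => deriv b s ^ 2) ε,
      Measure.integral_comp_mul_left (fun s => b s ^ 2) ε, abs_of_pos (inv_pos.2 hε)]
    simp only [smul_eq_mul]
    have := mul_lt_mul_of_pos_left hεA (inv_pos.2 hε)
    linarith

/-- The function `s ↦ exp (s / 2 - exp s) φ(s)`. -/
def weighted (φ : ℝ → ℝ) (s : ℝ) : ℝ := Real.exp (s / 2 - Real.exp s) * φ s

lemma weighted_contDiff {φ : ℝ → ℝ} (hφ : ContDiff ℝ (⊤ : ℕ∞) φ) :
    ContDiff ℝ (⊤ : ℕ∞) (weighted φ) := by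
  unfold weighted
  fun_prop

lemma weighted_hasDerivAt {φ : ℝ → ℝ} {s : ℝ} (hφ : DifferentiableAt ℝ φ s) :
    HasDerivAt (weighted φ)
      (Real.exp (s / 2 - Real.exp s) * (-Real.exp s * φ s + φ s / 2 + deriv φ s)) s := by
  have h1 : HasDerivAt (fun s : ℝ => s / 2 - Real.exp s) (1 / 2 - Real.exp s) s :=
    ((hasDerivAt_id s).div_const 2).sub (Real.hasDerivAt_exp s)
  exact (h1.exp.mul hφ.hasDerivAt).congr_deriv (by ring)

/-- The radial profile `r ↦ r⁻¹ (log r)^{1/2} φ(log log r)`, extended by zero to `r ≤ 1`. -/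
def logLogProfile (φ : ℝ → ℝ) (r : ℝ) : ℝ :=
  if 1 < r then weighted φ (Real.log (Real.log r)) else 0

lemma logLogProfile_of_le (φ : ℝ → ℝ) {r : ℝ} (hr : r ≤ 1) : logLogProfile φ r = 0 :=
  if_neg hr.not_gt

lemma logLogProfile_eventuallyEq (φ : ℝ → ℝ) {r : ℝ} (hr : 1 < r) :
    logLogProfile φ =ᶠ[nhds r] fun r => weighted φ (Real.log (Real.log r)) := by
  filter_upwards [lt_mem_nhds hr] with y hy using if_pos hy

lemma HasCompactSupport.exists_abs_bound {φ : ℝ → ℝ} (hφ : HasCompactSupport φ) :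
    ∃ M : ℝ, ∀ s, M ≤ |s| → φ s = 0 := by
  obtain ⟨M, -, hM⟩ := hφ.exists_pos_le_norm
  exact ⟨M, hM⟩

/-- The profile vanishes in a neighbourhood of `[0, 1]`. -/
lemma logLogProfile_eq_zero_of_lt {φ : ℝ → ℝ} (hφ : HasCompactSupport φ) :
    ∃ a : ℝ, 1 < a ∧ ∀ r < a, logLogProfile φ r = 0 := by
  obtain ⟨M, hM⟩ := hφ.exists_abs_bound
  refine ⟨Real.exp (Real.exp (-M)), Real.one_lt_exp_iff.2 (Real.exp_pos _), fun r hr => ?_⟩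
  by_cases h : 1 < r
  · have hlog : 0 < Real.log r := Real.log_pos h
    have : Real.log (Real.log r) < -M := by
      rwa [Real.log_lt_iff_lt_exp hlog, Real.log_lt_iff_lt_exp (by linarith)]
    rw [logLogProfile, if_pos h, weighted, hM _ (by linarith [neg_le_abs (Real.log (Real.log r))]),
      mul_zero]
  · exact logLogProfile_of_le φ (not_lt.1 h)

lemma logLogProfile_eq_zero_of_gt {φ : ℝ → ℝ} (hφ : HasCompactSupport φ) :
    ∃ b : ℝ, ∀ r, b < r → logLogProfile φ r = 0 := by
  obtain ⟨M, hM⟩ := hφ.exists_abs_bound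
  refine ⟨Real.exp (Real.exp M), fun r hr => ?_⟩
  have h : 1 < r := (Real.one_lt_exp_iff.2 (Real.exp_pos _)).trans hr
  have hlog : 0 < Real.log r := Real.log_pos h
  have : M < Real.log (Real.log r) := by
    rwa [Real.lt_log_iff_exp_lt hlog, Real.lt_log_iff_exp_lt (by linarith)]
  rw [logLogProfile, if_pos h, weighted, hM _ (by linarith [le_abs_self (Real.log (Real.log r))]),
    mul_zero]

lemma logLogProfile_contDiff {φ : ℝ → ℝ} (hφ : ContDiff ℝ (⊤ : ℕ∞) φ)
    (hc : HasCompactSupport φ) : ContDiff ℝ (⊤ : ℕ∞) (logLogProfile φ) := by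
  obtain ⟨a, ha, h0⟩ := logLogProfile_eq_zero_of_lt hc
  refine contDiff_iff_contDiffAt.2 fun r => ?_
  rcases lt_or_ge r a with h | h
  · refine (contDiffAt_const (c := (0 : ℝ))).congr_of_eventuallyEq ?_
    filter_upwards [gt_mem_nhds h] with y hy using h0 y hy
  · have hr : 1 < r := ha.trans_le h
    refine ContDiffAt.congr_of_eventuallyEq ?_ (logLogProfile_eventuallyEq φ hr)
    exact (weighted_contDiff hφ).contDiffAt.comp r
      ((contDiffAt_id.log (by simp; linarith)).log (Real.log_pos hr).ne')

lemma deriv_logLogProfile_of_le {φ : ℝ → ℝ} (hc : HasCompactSupport φ) {r : ℝ} (hr : r ≤ 1) :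
    deriv (logLogProfile φ) r = 0 := by
  obtain ⟨a, ha, h0⟩ := logLogProfile_eq_zero_of_lt hc
  have : logLogProfile φ =ᶠ[nhds r] fun _ => 0 := by
    filter_upwards [gt_mem_nhds (hr.trans_lt ha)] with y hy using h0 y hy
  rw [this.deriv_eq, deriv_const]

lemma logLogProfile_exp_exp (φ : ℝ → ℝ) (s : ℝ) :
    logLogProfile φ (Real.exp (Real.exp s)) = Real.exp (s / 2 - Real.exp s) * φ s := by
  rw [logLogProfile, if_pos (Real.one_lt_exp_iff.2 (Real.exp_pos _)), Real.log_exp, Real.log_exp,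
    weighted]

lemma deriv_logLogProfile_exp_exp {φ : ℝ → ℝ} (hφ : Differentiable ℝ φ) (s : ℝ) :
    deriv (logLogProfile φ) (Real.exp (Real.exp s)) =
      Real.exp (s / 2 - Real.exp s) * (-Real.exp s * φ s + φ s / 2 + deriv φ s) /
        (Real.exp (Real.exp s) * Real.exp s) := by
  have hr : 1 < Real.exp (Real.exp s) := Real.one_lt_exp_iff.2 (Real.exp_pos _)
  rw [(logLogProfile_eventuallyEq φ hr).deriv_eq]
  have h1 := ((Real.hasDerivAt_log (Real.exp_pos (Real.exp s)).ne').log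
    (by rw [Real.log_exp]; exact (Real.exp_pos s).ne'))
  have h2 : HasDerivAt (weighted φ) _ (Real.log (Real.log (Real.exp (Real.exp s)))) :=
    weighted_hasDerivAt (hφ _)
  have h3 : HasDerivAt (fun r => weighted φ (Real.log (Real.log r))) _ (Real.exp (Real.exp s)) :=
    HasDerivAt.comp (h₂ := weighted φ) (h := fun r => Real.log (Real.log r)) _ h2 h1
  rw [h3.deriv]
  simp only [Real.log_exp]
  field_simp

/-- The substitution `r = exp (exp s)` for functions vanishing on `(0, 1]`. -/
lemma integral_Ioi_eq_integral_exp_exp {G : ℝ → ℝ} (hG : ∀ r ≤ 1, G r = 0) :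
    ∫ r in Set.Ioi 0, G r =
      ∫ s, Real.exp s * Real.exp (Real.exp s) * G (Real.exp (Real.exp s)) := by
  have himage : (fun s => Real.exp (Real.exp s)) '' Set.univ = Set.Ioi 1 := by
    ext r
    simp only [Set.image_univ, Set.mem_range, Set.mem_Ioi]
    constructor
    · rintro ⟨s, rfl⟩
      exact Real.one_lt_exp_iff.2 (Real.exp_pos _)
    · intro hr
      exact ⟨Real.log (Real.log r), by
        rw [Real.exp_log (Real.log_pos hr), Real.exp_log (by linarith)]⟩
  have h1 : ∫ r in Set.Ioi 0, G r = ∫ r in Set.Ioi 1, G r :=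
    setIntegral_eq_of_subset_of_forall_sdiff_eq_zero measurableSet_Ioi
      (Set.Ioi_subset_Ioi zero_le_one) fun r hr => hG r (not_lt.1 hr.2)
  rw [h1, ← himage, integral_image_eq_integral_abs_deriv_smul MeasurableSet.univ
    (fun s _ => (Real.hasDerivAt_exp s).exp.hasDerivWithinAt)
    (fun x _ y _ h => Real.exp_injective (Real.exp_injective h)), setIntegral_univ]
  refine integral_congr_ae (.of_forall fun s => ?_)
  simp only [smul_eq_mul]
  rw [abs_of_pos (by positivity), mul_comm (Real.exp (Real.exp s))]

lemma exp_half_sub_exp_sq (s : ℝ) : Real.exp (s / 2 - Real.exp s) ^ 2 =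
    Real.exp s / Real.exp (Real.exp s) ^ 2 := by
  rw [← Real.exp_nat_mul, ← Real.exp_nat_mul, ← Real.exp_sub]
  congr 1
  push_cast
  ring

lemma integral_logLogProfile_sq (φ : ℝ → ℝ) :
    ∫ r in Set.Ioi 0, r ^ 2 * (logLogProfile φ r ^ 2 / r) = ∫ s, (Real.exp s * φ s) ^ 2 := by
  rw [integral_Ioi_eq_integral_exp_exp fun r hr => by simp [logLogProfile_of_le φ hr]]
  refine integral_congr_ae (.of_forall fun s => ?_)
  simp only [logLogProfile_exp_exp, mul_pow, exp_half_sub_exp_sq]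
  field_simp

lemma integral_logLogProfile_sq_div_log_sq (φ : ℝ → ℝ) :
    ∫ r in Set.Ioi 0, r ^ 2 * (logLogProfile φ r ^ 2 / (r * Real.log r ^ 2)) = ∫ s, φ s ^ 2 := by
  rw [integral_Ioi_eq_integral_exp_exp fun r hr => by simp [logLogProfile_of_le φ hr]]
  refine integral_congr_ae (.of_forall fun s => ?_)
  simp only [logLogProfile_exp_exp, mul_pow, exp_half_sub_exp_sq, Real.log_exp]
  field_simp

lemma integral_deriv_logLogProfile_sq {φ : ℝ → ℝ} (hφ : ContDiff ℝ (⊤ : ℕ∞) φ)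
    (hc : HasCompactSupport φ) :
    ∫ r in Set.Ioi 0, r ^ 2 * (r * deriv (logLogProfile φ) r ^ 2) =
      (∫ s, (Real.exp s * φ s) ^ 2) + 1 / 4 * (∫ s, φ s ^ 2) + ∫ s, deriv φ s ^ 2 := by
  have hd : Differentiable ℝ φ := hφ.differentiable (by simp)
  have hcont : Continuous φ := hφ.continuous
  have hcont' : Continuous (deriv φ) := hφ.continuous_deriv (by simp)
  have hexp : Continuous Real.exp := Real.continuous_exp
  have hsupp {f : ℝ → ℝ} (hf : Continuous f)
      (h : ∀ s, φ s = 0 → deriv φ s = 0 → f s = 0) : Integrable f := by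
    refine hf.integrable_of_hasCompactSupport ?_
    refine HasCompactSupport.intro (hc.isCompact.union hc.deriv.isCompact) fun s hs => ?_
    rw [Set.mem_union, not_or] at hs
    exact h s (image_eq_zero_of_notMem_tsupport hs.1) (image_eq_zero_of_notMem_tsupport hs.2)
  have hboundary : ∫ s, (φ s * deriv φ s - (Real.exp s * φ s ^ 2 +
      Real.exp s * (2 * φ s * deriv φ s))) = 0 := by
    refine integral_eq_zero_of_hasDerivAt_of_integrable
      (f := fun s => φ s ^ 2 / 2 - Real.exp s * φ s ^ 2) (fun s => ?_) ?_ ?_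
    · have h := (hd s).hasDerivAt
      exact (((h.pow 2).div_const 2).sub ((Real.hasDerivAt_exp s).mul (h.pow 2))).congr_deriv
        (by simp; ring)
    · exact hsupp (by fun_prop) fun s h _ => by simp [h]
    · exact hsupp (by fun_prop) fun s h _ => by simp [h]
  rw [integral_Ioi_eq_integral_exp_exp fun r hr => by simp [deriv_logLogProfile_of_le hc hr]]
  have hcongr : ∀ s, Real.exp s * Real.exp (Real.exp s) * (Real.exp (Real.exp s) ^ 2 *
      (Real.exp (Real.exp s) * deriv (logLogProfile φ) (Real.exp (Real.exp s)) ^ 2)) =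
      (((Real.exp s * φ s) ^ 2 + 1 / 4 * φ s ^ 2) + deriv φ s ^ 2) +
        (φ s * deriv φ s - (Real.exp s * φ s ^ 2 + Real.exp s * (2 * φ s * deriv φ s))) := by
    intro s
    rw [deriv_logLogProfile_exp_exp hd, div_pow, mul_pow, exp_half_sub_exp_sq]
    field_simp
    ring
  have i1 : Integrable fun s => (Real.exp s * φ s) ^ 2 :=
    hsupp (by fun_prop) fun s h _ => by simp [h]
  have i2 : Integrable fun s => 1 / 4 * φ s ^ 2 := hsupp (by fun_prop) fun s h _ => by simp [h]
  have i3 : Integrable fun s => deriv φ s ^ 2 := hsupp (by fun_prop) fun s _ h => by simp [h]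
  have i12 : Integrable fun s => (Real.exp s * φ s) ^ 2 + 1 / 4 * φ s ^ 2 := i1.add i2
  have i123 : Integrable fun s => (Real.exp s * φ s) ^ 2 + 1 / 4 * φ s ^ 2 + deriv φ s ^ 2 :=
    i12.add i3
  have i4 : Integrable fun s => φ s * deriv φ s - (Real.exp s * φ s ^ 2 +
      Real.exp s * (2 * φ s * deriv φ s)) := hsupp (by fun_prop) fun s h _ => by simp [h]
  simp only [hcongr]
  rw [integral_add i123 i4, hboundary, add_zero, integral_add i12 i3,
    integral_add i1 i2, integral_const_mul]

lemma hasFDerivAt_norm_of_ne_zero {E : Type*} [NormedAddCommGroup E] [InnerProductSpace ℝ E]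
    {x : E} (hx : x ≠ 0) : HasFDerivAt (fun y : E => ‖y‖) (‖x‖⁻¹ • innerSL ℝ x) x := by
  have hn : ‖x‖ ^ 2 ≠ 0 := by simpa using hx
  have h := ((hasStrictFDerivAt_norm_sq x).hasFDerivAt).sqrt hn
  have hfun : (fun y : E => √(‖y‖ ^ 2)) = fun y => ‖y‖ := by
    funext y
    exact Real.sqrt_sq (norm_nonneg y)
  rw [hfun, Real.sqrt_sq (norm_nonneg x)] at h
  refine h.congr_fderiv ?_
  ext v
  simp
  ring

/-- The radial spinor field `x ↦ f(|x|) e₀`. -/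
def radialSpinor (f : ℝ → ℝ) (x : E3) : C4 := f ‖x‖ • EuclideanSpace.single 0 1

lemma norm_radialSpinor_sq (f : ℝ → ℝ) (x : E3) : ‖radialSpinor f x‖ ^ 2 = f ‖x‖ ^ 2 := by
  simp [radialSpinor, norm_smul]

lemma pderiv3_radialSpinor {f : ℝ → ℝ} (hf : Differentiable ℝ f) (j : Fin 3) {x : E3}
    (hx : x ≠ 0) : pderiv3 j (radialSpinor f) x =
      (deriv f ‖x‖ * (‖x‖⁻¹ * x j)) • EuclideanSpace.single 0 1 := by
  have h : HasFDerivAt (radialSpinor f) _ x :=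
    ((hf ‖x‖).hasDerivAt.comp_hasFDerivAt x (hasFDerivAt_norm_of_ne_zero hx)).smul_const _
  rw [pderiv3, h.fderiv]
  simp [EuclideanSpace.inner_single_right]

lemma norm_diracD_radialSpinor_sq {f : ℝ → ℝ} (hf : Differentiable ℝ f) {x : E3} (hx : x ≠ 0) :
    ‖diracD (radialSpinor f) x‖ ^ 2 = deriv f ‖x‖ ^ 2 := by
  have hn : ‖x‖ ≠ 0 := by simpa using hx
  have hsq : ‖x‖ ^ 2 = x 0 ^ 2 + x 1 ^ 2 + x 2 ^ 2 := by
    rw [EuclideanSpace.real_norm_sq_eq, Fin.sum_univ_three]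
  set d := deriv f ‖x‖ * ‖x‖⁻¹
  have hD : ∑ j : Fin 3, mulVecE (diracAlpha j) (pderiv3 j (radialSpinor f) x) =
      !₂[(0 : ℂ), 0, (d * x 2 : ℝ), (d * x 0 : ℝ) + (d * x 1 : ℝ) * Complex.I] := by
    simp only [pderiv3_radialSpinor hf _ hx, Fin.sum_univ_three]
    ext i
    fin_cases i <;>
      simp [mulVecE, diracAlpha, pauli, finSumFinEquiv, Matrix.toLpLin_apply, Fin.addCases, d] <;>
      ring
  rw [diracD, hD, norm_smul, mul_pow, EuclideanSpace.norm_sq_eq, Fin.sum_univ_four]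
  simp only [Matrix.cons_val, norm_neg, Complex.norm_I, ← Complex.normSq_eq_norm_sq,
    Complex.normSq_add_mul_I, Complex.normSq_ofReal, map_zero]
  calc _ = d ^ 2 * (x 0 ^ 2 + x 1 ^ 2 + x 2 ^ 2) := by ring
    _ = deriv f ‖x‖ ^ 2 := by
      rw [← hsq, mul_pow, inv_pow, mul_assoc, inv_mul_cancel₀ (pow_ne_zero 2 hn), mul_one]

/-- sharpness of the constant 1/4. -/
theorem hardy_dirac_log_remainder_sharp (c : ℝ) (hc : 1 / 4 < c) :
    ∃ R : ℝ, 0 < R ∧ ∃ ψ : E3 → C4, ψ ≠ 0 ∧ ContDiff ℝ (⊤ : ℕ∞) ψ ∧ HasCompactSupport ψ ∧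
      (∫ x : E3, ‖x‖ * ‖diracD ψ x‖ ^ 2) <
        (∫ x : E3, ‖ψ x‖ ^ 2 / ‖x‖) +
          c * ∫ x : E3, ‖ψ x - (R / ‖x‖) • ψ ((R / ‖x‖) • x)‖ ^ 2 /
            (‖x‖ * (Real.log (‖x‖ / R)) ^ 2) := by
  obtain ⟨φ, hφ, hφc, hφ0, hlt⟩ := exists_testFunction_energy_lt (sub_pos.2 hc)
  set f := logLogProfile φ with hf_def
  have hf : ContDiff ℝ (⊤ : ℕ∞) f := logLogProfile_contDiff hφ hφc
  have hfd : Differentiable ℝ f := hf.differentiable (by simp)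
  refine ⟨1, one_pos, radialSpinor f, fun h => ?_, ?_, ?_, ?_⟩
  · have h1 := norm_radialSpinor_sq f
      (EuclideanSpace.single (0 : Fin 3) (Real.exp (Real.exp 0)) : E3)
    rw [h] at h1
    simp only [Pi.zero_apply, norm_zero, zero_pow two_ne_zero, PiLp.norm_single, Real.norm_eq_abs,
      Real.abs_exp, hf_def, logLogProfile_exp_exp] at h1
    exact pow_ne_zero 2 (mul_ne_zero (Real.exp_ne_zero _) hφ0) h1.symm
  · obtain ⟨a, ha, h0⟩ := logLogProfile_eq_zero_of_lt hφc
    refine contDiff_iff_contDiffAt.2 fun x => ?_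
    by_cases hx : x = 0
    · refine (contDiffAt_const (c := (0 : C4))).congr_of_eventuallyEq ?_
      have : ∀ᶠ y : E3 in nhds x, ‖y‖ < a :=
        continuous_norm.continuousAt.eventually_lt continuousAt_const (by simp [hx]; linarith)
      filter_upwards [this] with y hy
      simp [radialSpinor, hf_def, h0 _ hy]
    · exact (hf.contDiffAt.comp x (contDiffAt_norm ℝ hx)).smul contDiffAt_const
  · obtain ⟨b, hb⟩ := logLogProfile_eq_zero_of_gt hφc
    refine HasCompactSupport.intro (isCompact_closedBall (0 : E3) b) fun x hx => ?_
    simp [radialSpinor, hf_def, hb ‖x‖ (by simpa using hx)]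
  · have e1 : ∀ x : E3, ‖x‖ * ‖diracD (radialSpinor f) x‖ ^ 2 = ‖x‖ * deriv f ‖x‖ ^ 2 := by
      intro x
      by_cases hx : x = 0
      · simp [hx]
      · rw [norm_diracD_radialSpinor_sq hfd hx]
    have e2 : ∀ x : E3, ‖radialSpinor f x - (1 / ‖x‖) • radialSpinor f ((1 / ‖x‖) • x)‖ ^ 2 /
        (‖x‖ * Real.log (‖x‖ / 1) ^ 2) = f ‖x‖ ^ 2 / (‖x‖ * Real.log ‖x‖ ^ 2) := by
      intro x
      by_cases hx : x = 0
      · simp [hx]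
      · have h1 : ‖(1 / ‖x‖) • x‖ = 1 := by
          rw [norm_smul, norm_div, norm_norm, norm_one, one_div,
            inv_mul_cancel₀ (norm_ne_zero_iff.2 hx)]
        have h2 : radialSpinor f ((1 / ‖x‖) • x) = 0 := by
          rw [radialSpinor, h1, hf_def, logLogProfile_of_le φ le_rfl, zero_smul]
        rw [h2, smul_zero, sub_zero, norm_radialSpinor_sq, div_one]
    have key (G : ℝ → ℝ) : ∫ x : E3, G ‖x‖ =
        3 * volume.real (Metric.ball (0 : E3) 1) * ∫ r in Set.Ioi 0, r ^ 2 * G r := by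
      rw [integral_fun_norm_addHaar]
      simp [mul_assoc]
    have hK : 0 < 3 * volume.real (Metric.ball (0 : E3) 1) := by
      have := Metric.measure_ball_pos (volume : Measure E3) 0 one_pos
      have : 0 < volume.real (Metric.ball (0 : E3) 1) :=
        ENNReal.toReal_pos this.ne' measure_ball_lt_top.ne
      positivity
    simp only [e1, e2, norm_radialSpinor_sq]
    rw [key (fun r => r * deriv f r ^ 2), key (fun r => f r ^ 2 / r),
      key (fun r => f r ^ 2 / (r * Real.log r ^ 2)), integral_deriv_logLogProfile_sq hφ hφc,
      integral_logLogProfile_sq, integral_logLogProfile_sq_div_log_sq]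
    have := mul_lt_mul_of_pos_left hlt hK
    linarith
end
end

section
/- For all m, ε ∈ ℝ and every ψ ∈ C_c^∞(ℝ³;ℂ⁴): ∫_{ℝ³} |ψ(x)|²/|x| dx ≤ ∫_{ℝ³} |x| |(−iα·∇ψ)(x) + m βψ(x) + iε ψ(x)|² dx (Kato–Nenciu inequality). -/
open MeasureTheory Real Filter

noncomputable section

/-- The real-linear action of a matrix on `C4`. -/
def matCLM (M : Matrix (Fin 4) (Fin 4) ℂ) : C4 →L[ℝ] C4 :=
  LinearMap.toContinuousLinearMap ((Matrix.toEuclideanLin M).restrictScalars ℝ)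

lemma mulVecE_eq_matCLM (M : Matrix (Fin 4) (Fin 4) ℂ) (v : C4) : mulVecE M v = matCLM M v := rfl

lemma matCLM_apply (M : Matrix (Fin 4) (Fin 4) ℂ) (v : C4) (i : Fin 4) :
    matCLM M v i = ∑ k, M i k * v k := rfl

lemma inner_C4 (u v : C4) : inner ℝ u v =
    ∑ i : Fin 4, ((u i).re * (v i).re + (u i).im * (v i).im) := by
  simp [PiLp.inner_apply, Complex.inner, mul_comm]

lemma norm_sq_C4 (u : C4) : ‖u‖ ^ 2 = ∑ i : Fin 4, ((u i).re ^ 2 + (u i).im ^ 2) := by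
  rw [← real_inner_self_eq_norm_sq, inner_C4]
  simp only [sq]

lemma diracAlpha_0 : diracAlpha 0 = !![0,0,0,1;0,0,1,0;0,1,0,0;1,0,0,0] := by
  ext i j; fin_cases i <;> fin_cases j <;> rfl

lemma diracAlpha_1 :
    diracAlpha 1 =
      !![0,0,0,-Complex.I;0,0,Complex.I,0;0,-Complex.I,0,0;Complex.I,0,0,0] := by
  ext i j; fin_cases i <;> fin_cases j <;> rfl

lemma diracAlpha_2 : diracAlpha 2 = !![0,0,1,0;0,0,0,-1;1,0,0,0;0,-1,0,0] := by
  ext i j; fin_cases i <;> fin_cases j <;> rfl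

lemma diracBeta_eq : diracBeta = !![1,0,0,0;0,1,0,0;0,0,-1,0;0,0,0,-1] := by
  ext i j; fin_cases i <;> fin_cases j <;>
    simp [diracBeta, Matrix.reindex, finSumFinEquiv, Fin.addCases, Matrix.fromBlocks]

lemma spinMat_0 : spinMat 0 = !![0,1,0,0;1,0,0,0;0,0,0,1;0,0,1,0] := by
  ext i j; fin_cases i <;> fin_cases j <;> rfl

lemma spinMat_1 :
    spinMat 1 =
      !![0,-Complex.I,0,0;Complex.I,0,0,0;0,0,0,-Complex.I;0,0,Complex.I,0] := by
  ext i j; fin_cases i <;> fin_cases j <;> rfl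

lemma spinMat_2 : spinMat 2 = !![1,0,0,0;0,-1,0,0;0,0,1,0;0,0,0,-1] := by
  ext i j; fin_cases i <;> fin_cases j <;> rfl

/-- `i Σⱼ`. -/
def iSpin (j : Fin 3) : C4 →L[ℝ] C4 := matCLM (Complex.I • spinMat j)

/-- The hermitian matrix `ε αⱼ - i m αⱼ β`. -/
def massMat (m ε : ℝ) (j : Fin 3) : C4 →L[ℝ] C4 :=
  matCLM ((ε : ℂ) • diracAlpha j - (Complex.I * m) • (diracAlpha j * diracBeta))

lemma inner_iSpin_right (j : Fin 3) (u v : C4) :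
    inner ℝ u (iSpin j v) = - inner ℝ (iSpin j u) v := by
  fin_cases j <;> simp [inner_C4, iSpin, matCLM_apply, Fin.sum_univ_four, spinMat_0, spinMat_1,
    spinMat_2] <;> ring

lemma inner_iSpin_iSpin (j : Fin 3) (u v : C4) : inner ℝ (iSpin j u) (iSpin j v) = inner ℝ u v := by
  fin_cases j <;> simp [inner_C4, iSpin, matCLM_apply, Fin.sum_univ_four, spinMat_0, spinMat_1,
    spinMat_2] <;> ring

lemma norm_sq_iSpin_comb (n : E3) (S : C4) :
    ‖∑ j, n j • iSpin j S‖ ^ 2 = ‖n‖ ^ 2 * ‖S‖ ^ 2 := by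
  rw [EuclideanSpace.real_norm_sq_eq]
  simp [norm_sq_C4, iSpin, matCLM_apply, Fin.sum_univ_four, Fin.sum_univ_three, spinMat_0,
    spinMat_1, spinMat_2]
  ring

/-- A tangential triple satisfies the twistor-type Cauchy–Schwarz bound with constant `2`
instead of `3`. -/
lemma norm_sq_sum_iSpin_le (x : E3) (hx : x ≠ 0) (y : Fin 3 → C4) (hy : ∑ j, x j • y j = 0) :
    ‖∑ j, iSpin j (y j)‖ ^ 2 ≤ 2 * ∑ j, ‖y j‖ ^ 2 := by
  obtain ⟨S, hS⟩ : ∃ S, S = ∑ j, iSpin j (y j) := ⟨_, rfl⟩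
  obtain ⟨T, hT⟩ : ∃ T, T = ∑ j, x j • iSpin j S := ⟨_, rfl⟩
  obtain ⟨s, hs⟩ : ∃ s : ℝ, s = (‖x‖ ^ 2)⁻¹ := ⟨_, rfl⟩
  rw [← hS]
  have hs1 : s * ‖x‖ ^ 2 = 1 := hs ▸ inv_mul_cancel₀ (by positivity)
  have hnT : ‖T‖ ^ 2 = ‖x‖ ^ 2 * ‖S‖ ^ 2 := hT ▸ norm_sq_iSpin_comb x S
  have h1 : ∑ j, inner ℝ (iSpin j S) (y j) = - ‖S‖ ^ 2 := by
    rw [← real_inner_self_eq_norm_sq]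
    nth_rw 3 [hS]
    rw [inner_sum, ← Finset.sum_neg_distrib]
    exact Finset.sum_congr rfl fun j _ => by rw [inner_iSpin_right, neg_neg]
  have h2 : ∑ j, x j * inner ℝ T (y j) = 0 := by
    have := congrArg (inner ℝ T) hy
    simpa [inner_sum, inner_smul_right] using this
  have h3 : ∑ j, x j * inner ℝ (iSpin j S) T = ‖T‖ ^ 2 := by
    rw [← real_inner_self_eq_norm_sq]
    nth_rw 2 [hT]
    rw [sum_inner]
    exact Finset.sum_congr rfl fun j _ => by rw [inner_smul_left]; rfl
  have h4 : ∀ j, ‖iSpin j S‖ ^ 2 = ‖S‖ ^ 2 := fun j => by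
    rw [← real_inner_self_eq_norm_sq, inner_iSpin_iSpin, real_inner_self_eq_norm_sq]
  have key : ∀ j, ‖(2 : ℝ) • y j + (iSpin j S - (s * x j) • T)‖ ^ 2 =
      4 * ‖y j‖ ^ 2 + ‖S‖ ^ 2 + 4 * inner ℝ (iSpin j S) (y j) - 4 * s * (x j * inner ℝ T (y j))
        - 2 * s * (x j * inner ℝ (iSpin j S) T) + s ^ 2 * (x j) ^ 2 * ‖T‖ ^ 2 := by
    intro j
    rw [norm_add_sq_real, norm_sub_sq_real, h4, norm_smul, norm_smul, inner_sub_right,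
      inner_smul_left, inner_smul_left, inner_smul_right, inner_smul_right,
      real_inner_comm (iSpin j S) (y j), real_inner_comm T (y j), mul_pow, mul_pow,
      Real.norm_eq_abs, Real.norm_eq_abs, sq_abs, sq_abs]
    simp
    ring
  have hpos : 0 ≤ ∑ j, ‖(2 : ℝ) • y j + (iSpin j S - (s * x j) • T)‖ ^ 2 :=
    Finset.sum_nonneg fun j _ => sq_nonneg _
  have hx2 : ‖x‖ ^ 2 = x 0 ^ 2 + x 1 ^ 2 + x 2 ^ 2 := by
    rw [EuclideanSpace.real_norm_sq_eq, Fin.sum_univ_three]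
  simp only [key, Fin.sum_univ_three] at hpos h1 h2 h3 ⊢
  have h5 : s ^ 2 * (x 0 ^ 2 + x 1 ^ 2 + x 2 ^ 2) * ‖T‖ ^ 2 = ‖S‖ ^ 2 := by
    rw [hnT, ← hx2]
    calc _ = (s * ‖x‖ ^ 2) ^ 2 * ‖S‖ ^ 2 := by ring
      _ = _ := by rw [hs1]; ring
  have h6 : s * ‖T‖ ^ 2 = ‖S‖ ^ 2 := by rw [hnT, ← mul_assoc, hs1, one_mul]
  linear_combination (1 / 2 : ℝ) * hpos + 2 * h1 - 2 * s * h2 - s * h3 - h6 + (1 / 2 : ℝ) * h5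

lemma norm_sq_sum_iSpin (y : Fin 3 → C4) :
    ‖∑ j, iSpin j (y j)‖ ^ 2 - ∑ j, ‖y j‖ ^ 2 =
      2 * ∑ j, inner ℝ (y j) (iSpin (j + 2) (y (j + 1))) := by
  simp [inner_C4, norm_sq_C4, iSpin, matCLM_apply, Fin.sum_univ_four, Fin.sum_univ_three,
    spinMat_0, spinMat_1, spinMat_2]
  ring

/-- The matrix term produced by the mass and the spectral parameter. -/
def massTerm (m ε : ℝ) (x : E3) (v : C4) : C4 := ∑ j, x j • massMat m ε j v

lemma dirac_factorization (m ε : ℝ) (x : E3) (p : C4) (d : Fin 3 → C4) :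
    Complex.I • ∑ j, x j • matCLM (diracAlpha j)
      ((-Complex.I) • ∑ j : Fin 3, mulVecE (diracAlpha j) (d j)
        + (m : ℂ) • mulVecE diracBeta p + (Complex.I * ε) • p) =
    ∑ j, x j • d j + ∑ j, iSpin j (x (j + 1) • d (j + 2) - x (j + 2) • d (j + 1))
      - massTerm m ε x p := by
  ext i
  simp only [mulVecE_eq_matCLM, massTerm]
  fin_cases i <;>
  simp [massMat, iSpin, matCLM_apply, Fin.sum_univ_four, Fin.sum_univ_three, spinMat_0, spinMat_1,
    spinMat_2,
    diracAlpha_0, diracAlpha_1, diracAlpha_2, diracBeta_eq] <;> ring_nf <;> simp <;> ring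

lemma norm_sq_alpha_comb (x : E3) (v : C4) :
    ‖Complex.I • ∑ j, x j • matCLM (diracAlpha j) v‖ ^ 2 = ‖x‖ ^ 2 * ‖v‖ ^ 2 := by
  rw [norm_smul, Complex.norm_I, one_mul, EuclideanSpace.real_norm_sq_eq]
  simp [norm_sq_C4, matCLM_apply, Fin.sum_univ_four, Fin.sum_univ_three, diracAlpha_0,
    diracAlpha_1, diracAlpha_2]
  ring

lemma massTerm_anticomm (m ε : ℝ) (x : E3) (p : C4) (d : Fin 3 → C4) :
    2 * inner ℝ (massTerm m ε x p)
      (p - ∑ j, iSpin j (x (j + 1) • d (j + 2) - x (j + 2) • d (j + 1))) =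
    - ∑ j, (inner ℝ (massTerm m ε x p)
        (iSpin j (x (j + 1) • d (j + 2) - x (j + 2) • d (j + 1))) +
      inner ℝ (massTerm m ε x (x (j + 1) • d (j + 2) - x (j + 2) • d (j + 1)) +
        (x (j + 1) • massMat m ε (j + 2) p - x (j + 2) • massMat m ε (j + 1) p)) (iSpin j p)) := by
  simp only [massTerm]
  simp [inner_C4, massMat, iSpin, matCLM_apply, Fin.sum_univ_four, Fin.sum_univ_three, spinMat_0,
    spinMat_1, spinMat_2, diracAlpha_0, diracAlpha_1, diracAlpha_2, diracBeta_eq]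
  ring

/-- The derivative of `f` along the linear vector field `x ↦ A x`. -/
def linDeriv {F : Type*} [NormedAddCommGroup F] [NormedSpace ℝ F] (A : E3 →L[ℝ] E3) (f : E3 → F)
    (x : E3) : F := fderiv ℝ f x (A x)

section linDeriv

variable {F : Type*} [NormedAddCommGroup F] [NormedSpace ℝ F]

lemma ContDiff.linDeriv {f : E3 → F} (hf : ContDiff ℝ (⊤ : ℕ∞) f) (A : E3 →L[ℝ] E3) :
    ContDiff ℝ (⊤ : ℕ∞) (linDeriv A f) :=
  (hf.fderiv_right (m := (⊤ : ℕ∞)) (by simp)).clm_apply A.contDiff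

lemma linDeriv_comm_apply {f : E3 → F} (hf : ContDiff ℝ (⊤ : ℕ∞) f) (A A' : E3 →L[ℝ] E3) (x : E3) :
    linDeriv A (linDeriv A' f) x =
      linDeriv A' (linDeriv A f) x + fderiv ℝ f x (A' (A x) - A (A' x)) := by
  have hd : DifferentiableAt ℝ (fderiv ℝ f) x :=
    (hf.fderiv_right (m := (⊤ : ℕ∞)) (by simp)).differentiable (by simp) x
  have h : ∀ C : E3 →L[ℝ] E3, ∀ v, fderiv ℝ (linDeriv C f) x v =
      fderiv ℝ f x (C v) + fderiv ℝ (fderiv ℝ f) x v (C x) := by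
    intro C v
    have := (hd.hasFDerivAt.clm_apply (C.hasFDerivAt (x := x))).fderiv
    change fderiv ℝ (fun y => fderiv ℝ f y (C y)) x v = _
    rw [this]
    simp
  have hsymm : IsSymmSndFDerivAt ℝ f x :=
    hf.contDiffAt.isSymmSndFDerivAt (by simp; exact WithTop.coe_le_coe.mpr (le_top (a := (2 : ℕ∞))))
  rw [linDeriv, linDeriv, h, h, map_sub, hsymm.eq]
  abel

lemma linDeriv_inner {f g : E3 → C4} (hf : Differentiable ℝ f) (hg : Differentiable ℝ g)
    (A : E3 →L[ℝ] E3) (x : E3) :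
    linDeriv A (fun x => inner ℝ (f x) (g x)) x =
      inner ℝ (f x) (linDeriv A g x) + inner ℝ (linDeriv A f x) (g x) :=
  fderiv_inner_apply ℝ (hf x) (hg x) _

lemma linDeriv_clm {G : Type*} [NormedAddCommGroup G] [NormedSpace ℝ G] {f : E3 → F}
    (hf : Differentiable ℝ f) (L : F →L[ℝ] G) (A : E3 →L[ℝ] E3) (x : E3) :
    linDeriv A (fun x => L (f x)) x = L (linDeriv A f x) := by
  have := (L.hasFDerivAt.comp x (hf x).hasFDerivAt).fderiv
  change fderiv ℝ (L ∘ f) x (A x) = _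
  rw [this]; rfl

lemma linDeriv_add {f g : E3 → F} (hf : Differentiable ℝ f) (hg : Differentiable ℝ g)
    (A : E3 →L[ℝ] E3) (x : E3) : linDeriv A (fun x => f x + g x) x =
      linDeriv A f x + linDeriv A g x := by
  simp [linDeriv, fderiv_fun_add (hf x) (hg x)]

lemma linDeriv_sub {f g : E3 → F} (hf : Differentiable ℝ f) (hg : Differentiable ℝ g)
    (A : E3 →L[ℝ] E3) (x : E3) : linDeriv A (fun x => f x - g x) x =
      linDeriv A f x - linDeriv A g x := by
  simp [linDeriv, fderiv_fun_sub (hf x) (hg x)]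

lemma linDeriv_const_smul {f : E3 → F} (hf : Differentiable ℝ f) (c : ℝ)
    (A : E3 →L[ℝ] E3) (x : E3) : linDeriv A (fun x => c • f x) x = c • linDeriv A f x := by
  simp [linDeriv, fderiv_fun_const_smul (hf x)]

lemma linDeriv_sum {f : Fin 3 → E3 → F} (hf : ∀ j, Differentiable ℝ (f j))
    (A : E3 →L[ℝ] E3) (x : E3) : linDeriv A (fun x => ∑ j, f j x) x = ∑ j, linDeriv A (f j) x := by
  simp [linDeriv, fderiv_fun_sum fun j _ => hf j x]

lemma linDeriv_coord_smul {f : E3 → F} (hf : Differentiable ℝ f) (j : Fin 3) (A : E3 →L[ℝ] E3)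
    (x : E3) : linDeriv A (fun x => x j • f x) x = x j • linDeriv A f x + A x j • f x := by
  have h1 : HasFDerivAt (fun x : E3 => x j) (EuclideanSpace.proj j : E3 →L[ℝ] ℝ) x :=
    (EuclideanSpace.proj j : E3 →L[ℝ] ℝ).hasFDerivAt
  simp [linDeriv, (h1.fun_smul (hf x).hasFDerivAt).fderiv]

lemma linDeriv_eq_sum (A : E3 →L[ℝ] E3) (f : E3 → F) (x : E3) :
    linDeriv A f x = ∑ j, A x j • fderiv ℝ f x (EuclideanSpace.single j 1) := by
  have : A x = ∑ j, A x j • EuclideanSpace.single j (1 : ℝ) := by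
    ext i; fin_cases i <;> simp [Fin.sum_univ_three]
  rw [linDeriv]; nth_rw 1 [this]; simp only [map_sum, map_smul]

lemma HasCompactSupport.linDeriv {f : E3 → F} (hf : HasCompactSupport f) (A : E3 →L[ℝ] E3) :
    HasCompactSupport (linDeriv A f) :=
  (hf.fderiv ℝ).mono fun x hx => by
    contrapose! hx
    simp_all [_root_.linDeriv]

lemma integral_linDeriv {G : E3 → ℝ} (hG : ContDiff ℝ (⊤ : ℕ∞) G) (hs : HasCompactSupport G)
    (A : E3 →L[ℝ] E3) :
    ∫ x, linDeriv A G x = - (∑ j, A (EuclideanSpace.single j 1) j) * ∫ x, G x := by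
  have hc : ∀ j : Fin 3, Continuous fun x => fderiv ℝ G x (EuclideanSpace.single j 1) := fun j =>
    (hG.continuous_fderiv (by simp)).clm_apply continuous_const
  have hcs : ∀ j : Fin 3, HasCompactSupport fun x => fderiv ℝ G x (EuclideanSpace.single j 1) :=
    fun j => hs.fderiv_apply ℝ _
  have hAc : ∀ j : Fin 3, Continuous fun x => A x j := fun j => by fun_prop
  have hi : ∀ j : Fin 3, Integrable fun x => A x j * fderiv ℝ G x (EuclideanSpace.single j 1) :=
    fun j => ((hAc j).mul (hc j)).integrable_of_hasCompactSupport ((hcs j).mul_left)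
  have hGi : Integrable G := hG.continuous.integrable_of_hasCompactSupport hs
  have hd : ∀ (j : Fin 3) (x v : E3), fderiv ℝ (fun x => A x j) x v = A v j := fun j x v => by
    have : HasFDerivAt (fun x => A x j) ((EuclideanSpace.proj j : E3 →L[ℝ] ℝ) ∘L A) x :=
      ((EuclideanSpace.proj j : E3 →L[ℝ] ℝ) ∘L A).hasFDerivAt
    rw [this.fderiv]; rfl
  simp_rw [linDeriv_eq_sum, smul_eq_mul]
  rw [integral_finsetSum _ fun j _ => hi j, neg_mul, Finset.sum_mul, ← Finset.sum_neg_distrib]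
  refine Finset.sum_congr rfl fun j _ => ?_
  rw [integral_mul_fderiv_eq_neg_fderiv_mul_of_integrable]
  · simp_rw [hd, integral_const_mul]
  · simp_rw [hd]; exact hGi.const_mul _
  · exact hi j
  · exact ((hAc j).mul hG.continuous).integrable_of_hasCompactSupport hs.mul_left
  · intro x _
    exact ((EuclideanSpace.proj j : E3 →L[ℝ] ℝ) ∘L A).differentiableAt
  · intro x _
    exact hG.differentiable (by simp) x

end linDeriv

/-- Regularization of `1 / ‖x‖`. -/
def wt (δ : ℝ) (x : E3) : ℝ := (√(‖x‖ ^ 2 + δ ^ 2))⁻¹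

lemma contDiff_wt {δ : ℝ} (hδ : 0 < δ) : ContDiff ℝ (⊤ : ℕ∞) (wt δ) := by
  unfold wt
  refine ContDiff.inv (ContDiff.sqrt ((contDiff_norm_sq ℝ).add contDiff_const) ?_) ?_ <;>
  intro x <;> positivity

lemma wt_nonneg (δ : ℝ) (x : E3) : 0 ≤ wt δ x := by unfold wt; positivity

lemma wt_sq {δ : ℝ} (hδ : 0 < δ) (x : E3) : wt δ x ^ 2 * (‖x‖ ^ 2 + δ ^ 2) = 1 := by
  rw [wt, inv_pow, Real.sq_sqrt (by positivity)]
  exact inv_mul_cancel₀ (by positivity)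

lemma wt_mul_norm_le_one {δ : ℝ} (hδ : 0 < δ) (x : E3) : wt δ x * ‖x‖ ≤ 1 := by
  have h := wt_sq hδ x
  have h1 := wt_nonneg δ x
  refine abs_le_one_iff_mul_self_le_one.mpr ?_ |> (le_abs_self _).trans
  nlinarith [mul_nonneg (sq_nonneg (wt δ x)) (sq_nonneg δ)]

lemma linDeriv_wt {δ : ℝ} (hδ : 0 < δ) (A : E3 →L[ℝ] E3) (x : E3) :
    linDeriv A (wt δ) x = - inner ℝ x (A x) * wt δ x ^ 3 := by
  have hp : (‖x‖ ^ 2 + δ ^ 2) ≠ 0 := by positivity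
  have h1 : HasFDerivAt (fun x : E3 => ‖x‖ ^ 2 + δ ^ 2) (2 • innerSL ℝ x) x :=
    (hasStrictFDerivAt_norm_sq x).hasFDerivAt.add_const _
  have h2 := (HasDerivAt.inv (Real.hasDerivAt_sqrt hp) (by positivity)).comp_hasFDerivAt x h1
  have h3 : HasFDerivAt (wt δ) _ x := h2
  rw [linDeriv, h3.fderiv]
  have : √(‖x‖ ^ 2 + δ ^ 2) ≠ 0 := by positivity
  simp [wt]
  field_simp

lemma integral_wt_linDeriv {G : E3 → ℝ} (hG : ContDiff ℝ (⊤ : ℕ∞) G) (hs : HasCompactSupport G)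
    (A : E3 →L[ℝ] E3) {δ : ℝ} (hδ : 0 < δ) :
    ∫ x, wt δ x * linDeriv A G x = - (∑ j, A (EuclideanSpace.single j 1) j) * (∫ x, wt δ x * G x)
      + ∫ x, inner ℝ x (A x) * wt δ x ^ 3 * G x := by
  have hw := contDiff_wt hδ
  rw [← integral_linDeriv (hw.mul hG) hs.mul_left A, ← integral_add]
  · refine integral_congr_ae (.of_forall fun x => ?_)
    have h : linDeriv A (fun x => wt δ x * G x) x =
      wt δ x * linDeriv A G x + linDeriv A (wt δ) x * G x := by
      have := ((hw.differentiable (by simp) x).hasFDerivAt.mul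
        (hG.differentiable (by simp) x).hasFDerivAt).fderiv
      change fderiv ℝ (wt δ * G) x (A x) = _
      rw [this]
      simp [linDeriv, mul_comm]
    simp only [h, linDeriv_wt hδ]
    ring
  · exact ((hw.mul hG).linDeriv A).continuous.integrable_of_hasCompactSupport (hs.mul_left.linDeriv A)
  · refine Continuous.integrable_of_hasCompactSupport ?_ hs.mul_left
    have := hw.continuous
    have := hG.continuous
    fun_prop

/-- The linear vector field `x ↦ eⱼ × x`. -/
def rot (j : Fin 3) : E3 →L[ℝ] E3 :=
  (EuclideanSpace.proj (j + 1) : E3 →L[ℝ] ℝ).smulRight (EuclideanSpace.single (j + 2) (1 : ℝ))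
    - (EuclideanSpace.proj (j + 2) : E3 →L[ℝ] ℝ).smulRight (EuclideanSpace.single (j + 1) (1 : ℝ))

lemma rot_apply (j : Fin 3) (x : E3) : rot j x =
    x (j + 1) • EuclideanSpace.single (j + 2) (1 : ℝ)
      - x (j + 2) • EuclideanSpace.single (j + 1) (1 : ℝ) := rfl

lemma inner_rot (j : Fin 3) (x : E3) : inner ℝ x (rot j x) = 0 := by
  simp [rot_apply, inner_sub_right, inner_smul_right, EuclideanSpace.inner_single_right]
  ring

lemma trace_rot (j : Fin 3) : ∑ k, rot j (EuclideanSpace.single k 1) k = 0 := by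
  fin_cases j <;> simp [rot_apply, Fin.sum_univ_three]

lemma rot_rot (j : Fin 3) (x : E3) :
    rot (j + 1) (rot j x) - rot j (rot (j + 1) x) = - rot (j + 2) x := by
  ext k
  fin_cases j <;> fin_cases k <;> simp [rot_apply]

lemma linDeriv_rot (j : Fin 3) (ψ : E3 → C4) (x : E3) :
    linDeriv (rot j) ψ x = x (j + 1) • pderiv3 (j + 2) ψ x - x (j + 2) • pderiv3 (j + 1) ψ x := by
  simp [linDeriv, rot_apply, pderiv3]

lemma linDeriv_id (ψ : E3 → C4) (x : E3) :
    linDeriv (.id ℝ E3) ψ x = ∑ j, x j • pderiv3 j ψ x := by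
  rw [linDeriv_eq_sum]; rfl

/-- The operator `∑ⱼ iΣⱼ (x × ∇)ⱼ`. -/
def spinOrbit (ψ : E3 → C4) (x : E3) : C4 := ∑ j, iSpin j (linDeriv (rot j) ψ x)

lemma norm_sq_spinOrbit_le (ψ : E3 → C4) (x : E3) :
    ‖spinOrbit ψ x‖ ^ 2 ≤ 2 * ∑ j, ‖linDeriv (rot j) ψ x‖ ^ 2 := by
  rcases eq_or_ne x 0 with rfl | hx
  · simp [spinOrbit, linDeriv]
  · refine norm_sq_sum_iSpin_le x hx _ ?_
    simp only [linDeriv_rot, Fin.sum_univ_three]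
    simp only [zero_add, Fin.reduceAdd]
    module

lemma norm_sq_dirac (m ε : ℝ) (ψ : E3 → C4) (x : E3) :
    ‖x‖ ^ 2 * ‖diracD ψ x + (m : ℂ) • mulVecE diracBeta (ψ x) + (Complex.I * ε) • ψ x‖ ^ 2 =
      ‖linDeriv (.id ℝ E3) ψ x + spinOrbit ψ x - massTerm m ε x (ψ x)‖ ^ 2 := by
  rw [← norm_sq_alpha_comb, diracD, dirac_factorization, linDeriv_id, spinOrbit]
  simp only [linDeriv_rot]

/-- The pointwise inequality behind the theorem, for the values `p`, `e`, `y`, `Z`, `H` at a point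
of a spinor, of its radial and angular derivatives, and of its second derivatives. -/
lemma jet_inequality (p e N : C4) (y Z : Fin 3 → C4) (H : Fin 3 → Fin 3 → C4) (M : ℝ)
    (hH : ∀ j, H j (j + 1) = H (j + 1) j - y (j + 2))
    (hM : 2 * inner ℝ N (p - ∑ j, iSpin j (y j)) = - M)
    (hy : ‖∑ j, iSpin j (y j)‖ ^ 2 ≤ 2 * ∑ j, ‖y j‖ ^ 2) :
    ‖p‖ ^ 2 - (inner ℝ p (e - ∑ j, iSpin j (Z j)) + inner ℝ e (p - ∑ j, iSpin j (y j))
        + 2 * inner ℝ p (p - ∑ j, iSpin j (y j)))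
      + ∑ j, (inner ℝ p ((2 : ℝ) • (iSpin (j + 2) (H j (j + 1)) - iSpin (j + 1) (H j (j + 2)))
            - iSpin j (Z j))
          + inner ℝ (y j) ((2 : ℝ) • (iSpin (j + 2) (y (j + 1)) - iSpin (j + 1) (y (j + 2)))
            - iSpin j e)) - M
      ≤ ‖e + ∑ j, iSpin j (y j) - N‖ ^ 2 := by
  have hs := norm_sq_sum_iSpin y
  have hnn : 0 ≤ ‖e + p - N‖ ^ 2 := sq_nonneg _
  have hexp : ‖e + ∑ j, iSpin j (y j) - N‖ ^ 2 = ‖e + p - N‖ ^ 2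
      - 2 * inner ℝ (e + p - N) (p - ∑ j, iSpin j (y j)) + ‖p - ∑ j, iSpin j (y j)‖ ^ 2 := by
    rw [← norm_sub_sq_real]; congr 2; abel
  have h0 := hH 0
  have h1 := hH 1
  have h2 := hH 2
  simp only [zero_add, Fin.reduceAdd] at h0 h1 h2
  rw [hexp, norm_sub_sq_real p]
  have hflip : ∀ (j k l : Fin 3), inner ℝ (y k) (iSpin l (y j)) = - inner ℝ (y j) (iSpin l (y k)) :=
    fun j k l => by rw [inner_iSpin_right, real_inner_comm]
  have hfe : ∀ (j : Fin 3), inner ℝ (y j) (iSpin j e) = - inner ℝ e (iSpin j (y j)) :=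
    fun j => by rw [inner_iSpin_right, real_inner_comm]
  simp only [inner_sub_left, inner_sub_right, inner_add_left, inner_add_right, Fin.sum_univ_three,
    inner_smul_right, zero_add, Fin.reduceAdd, h0, h1, h2, map_sub, hfe,
    real_inner_self_eq_norm_sq, real_inner_comm e p] at hM hs hy ⊢
  rw [hflip 0 1 2, hflip 0 2 1, hflip 1 2 0]
  rw [hflip 0 2 1] at hs
  linarith

/-- Radial potential. -/
def radPot (ψ : E3 → C4) (x : E3) : ℝ := inner ℝ (ψ x) (ψ x - spinOrbit ψ x)

/-- Angular potentials. -/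
def angPot (m ε : ℝ) (ψ : E3 → C4) (j : Fin 3) (x : E3) : ℝ :=
  inner ℝ (ψ x) ((2 : ℝ) • (iSpin (j + 2) (linDeriv (rot (j + 1)) ψ x)
      - iSpin (j + 1) (linDeriv (rot (j + 2)) ψ x)) - iSpin j (linDeriv (.id ℝ E3) ψ x))
    - inner ℝ (massTerm m ε x (ψ x)) (iSpin j (ψ x))

lemma contDiff_iSpin {ψ : E3 → C4} (hψ : ContDiff ℝ (⊤ : ℕ∞) ψ) (j : Fin 3) :
    ContDiff ℝ (⊤ : ℕ∞) fun x => iSpin j (ψ x) :=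
  (iSpin j).contDiff.comp hψ

lemma contDiff_spinOrbit {ψ : E3 → C4} (hψ : ContDiff ℝ (⊤ : ℕ∞) ψ) : ContDiff ℝ (⊤ : ℕ∞)
    (spinOrbit ψ) :=
  ContDiff.sum fun j _ => contDiff_iSpin (hψ.linDeriv _) j

lemma contDiff_coord_massMat {ψ : E3 → C4} (hψ : ContDiff ℝ (⊤ : ℕ∞) ψ) (m ε : ℝ) (j : Fin 3) :
    ContDiff ℝ (⊤ : ℕ∞) fun x : E3 => x j • massMat m ε j (ψ x) :=
  (EuclideanSpace.proj j : E3 →L[ℝ] ℝ).contDiff.smul ((massMat m ε j).contDiff.comp hψ)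

lemma contDiff_massTerm {ψ : E3 → C4} (hψ : ContDiff ℝ (⊤ : ℕ∞) ψ) (m ε : ℝ) :
    ContDiff ℝ (⊤ : ℕ∞) fun x => massTerm m ε x (ψ x) :=
  ContDiff.sum fun j _ => contDiff_coord_massMat hψ m ε j

lemma contDiff_radPot {ψ : E3 → C4} (hψ : ContDiff ℝ (⊤ : ℕ∞) ψ) : ContDiff ℝ (⊤ : ℕ∞) (radPot ψ) :=
  hψ.inner ℝ (hψ.sub (contDiff_spinOrbit hψ))

lemma contDiff_angVec {ψ : E3 → C4} (hψ : ContDiff ℝ (⊤ : ℕ∞) ψ) (j : Fin 3) :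
    ContDiff ℝ (⊤ : ℕ∞) fun x =>
    (2 : ℝ) • (iSpin (j + 2) (linDeriv (rot (j + 1)) ψ x)
      - iSpin (j + 1) (linDeriv (rot (j + 2)) ψ x)) - iSpin j (linDeriv (.id ℝ E3) ψ x) :=
  (((contDiff_iSpin (hψ.linDeriv _) _).sub
    (contDiff_iSpin (hψ.linDeriv _) _)).const_smul _).sub (contDiff_iSpin (hψ.linDeriv _) _)

lemma contDiff_angPot {ψ : E3 → C4} (hψ : ContDiff ℝ (⊤ : ℕ∞) ψ) (m ε : ℝ) (j : Fin 3) :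
    ContDiff ℝ (⊤ : ℕ∞) (angPot m ε ψ j) :=
  (hψ.inner ℝ (contDiff_angVec hψ j)).sub
    ((contDiff_massTerm hψ m ε).inner ℝ (contDiff_iSpin hψ j))

lemma linDeriv_massTerm {ψ : E3 → C4} (hψ : ContDiff ℝ (⊤ : ℕ∞) ψ) (m ε : ℝ) (j : Fin 3) (x : E3) :
    linDeriv (rot j) (fun x => massTerm m ε x (ψ x)) x =
      massTerm m ε x (linDeriv (rot j) ψ x)
        + (x (j + 1) • massMat m ε (j + 2) (ψ x) - x (j + 2) • massMat m ε (j + 1) (ψ x)) := by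
  have hd := hψ.differentiable (by simp)
  have hc : ∀ k, Differentiable ℝ fun x => massMat m ε k (ψ x) := fun k =>
    ((massMat m ε k).contDiff.comp hψ).differentiable (by simp)
  unfold massTerm
  rw [linDeriv_sum fun k => (contDiff_coord_massMat hψ m ε k).differentiable (by simp)]
  simp_rw [fun k => linDeriv_coord_smul (hc k) k (rot j) x,
    linDeriv_clm hd, Finset.sum_add_distrib]
  congr 1
  fin_cases j <;> simp [rot_apply, Fin.sum_univ_three] <;> abel

lemma linDeriv_radPot {ψ : E3 → C4} (hψ : ContDiff ℝ (⊤ : ℕ∞) ψ) (x : E3) : linDeriv (.id ℝ E3)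
    (radPot ψ) x =
    inner ℝ (ψ x) (linDeriv (.id ℝ E3) ψ x
      - ∑ j, iSpin j (linDeriv (rot j) (linDeriv (.id ℝ E3) ψ) x))
    + inner ℝ (linDeriv (.id ℝ E3) ψ x) (ψ x - spinOrbit ψ x) := by
  have hd := hψ.differentiable (by simp)
  have hds := (contDiff_spinOrbit hψ).differentiable (by simp)
  unfold radPot
  rw [linDeriv_inner hd (hd.fun_sub hds), linDeriv_sub hd hds]
  unfold spinOrbit
  rw [linDeriv_sum fun j => (contDiff_iSpin (hψ.linDeriv _) j).differentiable (by simp)]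
  have hdA : ∀ A, Differentiable ℝ (linDeriv A ψ) := fun A =>
    (hψ.linDeriv A).differentiable (by simp)
  simp_rw [fun j => linDeriv_clm (hdA (rot j)) (iSpin j) (.id ℝ E3) x,
    fun j => linDeriv_comm_apply hψ (.id ℝ E3) (rot j) x]
  simp

lemma linDeriv_angPot {ψ : E3 → C4} (hψ : ContDiff ℝ (⊤ : ℕ∞) ψ) (m ε : ℝ) (j : Fin 3) (x : E3) :
    linDeriv (rot j) (angPot m ε ψ j) x =
      (inner ℝ (ψ x) ((2 : ℝ) • (iSpin (j + 2) (linDeriv (rot j) (linDeriv (rot (j + 1)) ψ) x)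
          - iSpin (j + 1) (linDeriv (rot j) (linDeriv (rot (j + 2)) ψ) x))
          - iSpin j (linDeriv (rot j) (linDeriv (.id ℝ E3) ψ) x))
        + inner ℝ (linDeriv (rot j) ψ x) ((2 : ℝ) • (iSpin (j + 2) (linDeriv (rot (j + 1)) ψ x)
          - iSpin (j + 1) (linDeriv (rot (j + 2)) ψ x)) - iSpin j (linDeriv (.id ℝ E3) ψ x)))
      - (inner ℝ (massTerm m ε x (ψ x)) (iSpin j (linDeriv (rot j) ψ x))
        + inner ℝ (massTerm m ε x (linDeriv (rot j) ψ x)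
          + (x (j + 1) • massMat m ε (j + 2) (ψ x) - x (j + 2) • massMat m ε (j + 1) (ψ x)))
          (iSpin j (ψ x))) := by
  have hd := hψ.differentiable (by simp)
  have hdA : ∀ A, Differentiable ℝ (linDeriv A ψ) := fun A =>
    (hψ.linDeriv A).differentiable (by simp)
  have hdi : ∀ A k, Differentiable ℝ fun x => iSpin k (linDeriv A ψ x) := fun A k =>
    (contDiff_iSpin (hψ.linDeriv A) k).differentiable (by simp)
  have hv := (contDiff_angVec hψ j).differentiable (by simp)
  have hm := (contDiff_massTerm hψ m ε).differentiable (by simp)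
  have hi := (contDiff_iSpin hψ j).differentiable (by simp)
  unfold angPot
  rw [linDeriv_sub (hd.inner ℝ hv) (hm.inner ℝ hi), linDeriv_inner hd hv, linDeriv_inner hm hi,
    linDeriv_massTerm hψ, linDeriv_clm hd,
    linDeriv_sub (((hdi _ _).fun_sub (hdi _ _)).fun_const_smul _) (hdi _ _),
    linDeriv_const_smul ((hdi _ _).fun_sub (hdi _ _)), linDeriv_sub (hdi _ _) (hdi _ _),
    linDeriv_clm (hdA _), linDeriv_clm (hdA _), linDeriv_clm (hdA _)]

lemma norm_sq_dirac_ge {ψ : E3 → C4} (hψ : ContDiff ℝ (⊤ : ℕ∞) ψ) (m ε : ℝ) (x : E3) :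
    ‖ψ x‖ ^ 2 - (linDeriv (.id ℝ E3) (radPot ψ) x + 2 * radPot ψ x)
      + ∑ j, linDeriv (rot j) (angPot m ε ψ j) x ≤
    ‖x‖ ^ 2 * ‖diracD ψ x + (m : ℂ) • mulVecE diracBeta (ψ x) + (Complex.I * ε) • ψ x‖ ^ 2 := by
  rw [norm_sq_dirac]
  simp_rw [linDeriv_angPot hψ, Finset.sum_sub_distrib]
  rw [linDeriv_radPot hψ, radPot, ← add_sub_assoc]
  refine jet_inequality _ _ _ (fun j => linDeriv (rot j) ψ x)
    (fun j => linDeriv (rot j) (linDeriv (.id ℝ E3) ψ) x)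
    (fun j k => linDeriv (rot j) (linDeriv (rot k) ψ) x) _ (fun j => ?_) ?_
    (norm_sq_spinOrbit_le ψ x)
  · rw [linDeriv_comm_apply hψ, rot_rot, map_neg, ← sub_eq_add_neg]; rfl
  · simp only [linDeriv_rot]
    exact massTerm_anticomm m ε x (ψ x) fun j => pderiv3 j ψ x

lemma norm_spinOrbit_le (ψ : E3 → C4) (x : E3) :
    ‖spinOrbit ψ x‖ ≤ (∑ j, ‖rot j‖) * ‖fderiv ℝ ψ x‖ * ‖x‖ := by
  rw [Finset.sum_mul, Finset.sum_mul]
  refine norm_sum_le_of_le _ fun j _ => ?_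
  have h : ‖iSpin j (linDeriv (rot j) ψ x)‖ = ‖linDeriv (rot j) ψ x‖ := by
    rw [← sq_eq_sq₀ (norm_nonneg _) (norm_nonneg _), ← real_inner_self_eq_norm_sq,
      inner_iSpin_iSpin, real_inner_self_eq_norm_sq]
  rw [h]
  calc _ ≤ ‖fderiv ℝ ψ x‖ * ‖rot j x‖ := (fderiv ℝ ψ x).le_opNorm _
    _ ≤ ‖fderiv ℝ ψ x‖ * (‖rot j‖ * ‖x‖) := by gcongr; exact (rot j).le_opNorm x
    _ = _ := by ring

lemma abs_radPot_le (ψ : E3 → C4) (x : E3) :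
    |radPot ψ x| ≤ ‖ψ x‖ ^ 2 + (∑ j, ‖rot j‖) * ‖fderiv ℝ ψ x‖ * ‖ψ x‖ * ‖x‖ := by
  rw [radPot, inner_sub_right, real_inner_self_eq_norm_sq]
  calc _ ≤ |‖ψ x‖ ^ 2| + |inner ℝ (ψ x) (spinOrbit ψ x)| := abs_sub _ _
    _ ≤ ‖ψ x‖ ^ 2 + ‖ψ x‖ * ((∑ j, ‖rot j‖) * ‖fderiv ℝ ψ x‖ * ‖x‖) := by
      rw [abs_of_nonneg (sq_nonneg _)]
      gcongr
      exact (abs_real_inner_le_norm _ _).trans (by gcongr; exact norm_spinOrbit_le ψ x)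
    _ = _ := by ring

lemma wt_le_inv {δ : ℝ} (hδ : 0 < δ) {x : E3} (hx : x ≠ 0) : wt δ x ≤ ‖x‖⁻¹ := by
  rw [← one_div, le_div_iff₀ (norm_pos_iff.mpr hx)]
  exact wt_mul_norm_le_one hδ x

lemma wt_cube_mul_le {δ : ℝ} (hδ : 0 < δ) (x : E3) : δ ^ 2 * wt δ x ^ 3 ≤ wt δ x := by
  have h := wt_sq hδ x
  have h1 := wt_nonneg δ x
  have h2 : δ ^ 2 * wt δ x ^ 2 ≤ 1 := by nlinarith [sq_nonneg (wt δ x * ‖x‖)]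
  calc _ = (δ ^ 2 * wt δ x ^ 2) * wt δ x := by ring
    _ ≤ _ := mul_le_of_le_one_left h1 h2

lemma tendsto_wt {x : E3} (hx : x ≠ 0) : Tendsto (fun δ => wt δ x) (nhds 0) (nhds ‖x‖⁻¹) := by
  have hc : ContinuousAt (fun δ => wt δ x) 0 := by
    unfold wt
    have : √(‖x‖ ^ 2 + (0 : ℝ) ^ 2) ≠ 0 := by positivity
    fun_prop (disch := assumption)
  have h0 : wt 0 x = ‖x‖⁻¹ := by simp [wt]
  rw [← h0]
  exact hc

lemma hasCompactSupport_radPot {ψ : E3 → C4} (hs : HasCompactSupport ψ) :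
    HasCompactSupport (radPot ψ) :=
  hs.mono fun x hx => by
    contrapose! hx
    simp_all [radPot]

lemma hasCompactSupport_angPot {ψ : E3 → C4} (hs : HasCompactSupport ψ) (m ε : ℝ) (j : Fin 3) :
    HasCompactSupport (angPot m ε ψ j) :=
  hs.mono fun x hx => by
    contrapose! hx
    simp_all [angPot]

/-- The Kato–Nenciu inequality with the weight `1 / ‖x‖` on the left replaced by its smooth
regularization, up to an error that vanishes with `δ`. -/
lemma regularized_inequality {ψ : E3 → C4} (hψ : ContDiff ℝ (⊤ : ℕ∞) ψ)
    (hs : HasCompactSupport ψ) (m ε : ℝ) {δ : ℝ} (hδ : 0 < δ) :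
    ∫ x, (wt δ x * ‖ψ x‖ ^ 2 + δ ^ 2 * wt δ x ^ 3 * radPot ψ x) ≤
      ∫ x : E3, ‖x‖ *
        ‖diracD ψ x + (m : ℂ) • mulVecE diracBeta (ψ x) + (Complex.I * ε) • ψ x‖ ^ 2 := by
  have hw : Continuous (wt δ) := (contDiff_wt hδ).continuous
  have hgc := contDiff_radPot hψ
  have hgs := hasCompactSupport_radPot hs
  have hac := contDiff_angPot hψ m ε
  have has := hasCompactSupport_angPot hs m ε
  have hψc := hψ.continuous
  have hrc := hgc.continuous
  have hLr := (hgc.linDeriv (.id ℝ E3)).continuous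
  have hLa := fun j => ((hac j).linDeriv (rot j)).continuous
  have i1 : Integrable fun x => wt δ x * ‖ψ x‖ ^ 2 :=
    Continuous.integrable_of_hasCompactSupport (by fun_prop)
      (hs.mono fun x hx => by contrapose! hx; simp_all)
  have i2 : Integrable fun x => wt δ x * linDeriv (.id ℝ E3) (radPot ψ) x :=
    (hw.mul hLr).integrable_of_hasCompactSupport (hgs.linDeriv _).mul_left
  have i3 : Integrable fun x => wt δ x * radPot ψ x :=
    (hw.mul hrc).integrable_of_hasCompactSupport hgs.mul_left
  have i4 : ∀ j, Integrable fun x => wt δ x * linDeriv (rot j) (angPot m ε ψ j) x := fun j =>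
    (hw.mul (hLa j)).integrable_of_hasCompactSupport ((has j).linDeriv _).mul_left
  have i5 : Integrable fun x => ‖x‖ ^ 2 * wt δ x ^ 3 * radPot ψ x :=
    Continuous.integrable_of_hasCompactSupport (by fun_prop) hgs.mul_left
  have i6 : Integrable fun x : E3 => ‖x‖ *
      ‖diracD ψ x + (m : ℂ) • mulVecE diracBeta (ψ x) + (Complex.I * ε) • ψ x‖ ^ 2 := by
    have hp : ∀ j, Continuous (pderiv3 j ψ) := fun j =>
      (hψ.continuous_fderiv (by simp)).clm_apply continuous_const
    refine Continuous.integrable_of_hasCompactSupport ?_ ?_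
    · unfold diracD
      simp_rw [mulVecE_eq_matCLM]
      fun_prop
    · refine HasCompactSupport.intro hs fun x hx => ?_
      have h0 : ψ x = 0 := image_eq_zero_of_notMem_tsupport hx
      have h1 : fderiv ℝ ψ x = 0 := fderiv_of_notMem_tsupport ℝ hx
      simp [diracD, pderiv3, mulVecE_eq_matCLM, h0, h1]
  have i7 : Integrable fun x => wt δ x * radPot ψ x - ‖x‖ ^ 2 * wt δ x ^ 3 * radPot ψ x :=
    i3.sub i5
  have i8 : Integrable fun x => wt δ x * linDeriv (.id ℝ E3) (radPot ψ) x
      + 2 * (wt δ x * radPot ψ x) := i2.add (i3.const_mul 2)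
  have i9 : Integrable fun x => wt δ x * ‖ψ x‖ ^ 2 - (wt δ x * linDeriv (.id ℝ E3) (radPot ψ) x
      + 2 * (wt δ x * radPot ψ x)) := i1.sub i8
  have i10 : Integrable fun x => ∑ j, wt δ x * linDeriv (rot j) (angPot m ε ψ j) x :=
    integrable_finsetSum _ fun j _ => i4 j
  have r := integral_wt_linDeriv hgc hgs (.id ℝ E3) hδ
  have a : ∀ j, ∫ x, wt δ x * linDeriv (rot j) (angPot m ε ψ j) x = 0 := fun j => by
    rw [integral_wt_linDeriv (hac j) (has j) (rot j) hδ]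
    simp [inner_rot, trace_rot]
  have htr : ∑ j : Fin 3, (ContinuousLinearMap.id ℝ E3) (EuclideanSpace.single j 1) j = 3 := by
    simp
  rw [htr] at r
  simp only [ContinuousLinearMap.id_apply, real_inner_self_eq_norm_sq] at r
  calc ∫ x, (wt δ x * ‖ψ x‖ ^ 2 + δ ^ 2 * wt δ x ^ 3 * radPot ψ x)
      = ∫ x, (wt δ x * ‖ψ x‖ ^ 2 + (wt δ x * radPot ψ x
          - ‖x‖ ^ 2 * wt δ x ^ 3 * radPot ψ x)) := by
        congr 1; ext x
        linear_combination wt δ x * radPot ψ x * wt_sq hδ x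
    _ = (∫ x, wt δ x * ‖ψ x‖ ^ 2) - ((∫ x, wt δ x * linDeriv (.id ℝ E3) (radPot ψ) x)
          + 2 * ∫ x, wt δ x * radPot ψ x)
          + ∑ j, ∫ x, wt δ x * linDeriv (rot j) (angPot m ε ψ j) x := by
        rw [integral_add i1 i7, integral_sub i3 i5, r]
        simp only [a, Finset.sum_const_zero]
        ring
    _ = ∫ x, (wt δ x * ‖ψ x‖ ^ 2 - (wt δ x * linDeriv (.id ℝ E3) (radPot ψ) x
          + 2 * (wt δ x * radPot ψ x))
          + ∑ j, wt δ x * linDeriv (rot j) (angPot m ε ψ j) x) := by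
        rw [integral_add i9 i10, integral_sub i1 i8, integral_add i2 (i3.const_mul 2),
          integral_const_mul, integral_finsetSum _ fun j _ => i4 j]
    _ ≤ _ := by
        refine integral_mono (i9.add i10) i6 fun x => ?_
        have h := mul_le_mul_of_nonneg_left (norm_sq_dirac_ge hψ m ε x) (wt_nonneg δ x)
        rw [mul_add, Finset.mul_sum] at h
        refine le_trans (le_of_eq (by ring)) (h.trans ?_)
        calc _ = (wt δ x * ‖x‖) * (‖x‖ *
              ‖diracD ψ x + (m : ℂ) • mulVecE diracBeta (ψ x) + (Complex.I * ε) • ψ x‖ ^ 2) := by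
              ring
          _ ≤ _ := mul_le_of_le_one_left (by positivity) (wt_mul_norm_le_one hδ x)

/-- Kato–Nenciu inequality. -/
theorem kato_nenciu (m ε : ℝ) (ψ : E3 → C4) (hsmooth : ContDiff ℝ (⊤ : ℕ∞) ψ)
    (hsupp : HasCompactSupport ψ) :
    (∫ x : E3, ‖ψ x‖ ^ 2 / ‖x‖) ≤
      ∫ x : E3, ‖x‖ *
        ‖diracD ψ x + (m : ℂ) • mulVecE diracBeta (ψ x) + (Complex.I * ε) • ψ x‖ ^ 2 := by
  by_cases hint : Integrable fun x : E3 => ‖ψ x‖ ^ 2 / ‖x‖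
  swap
  · rw [integral_undef hint]
    exact integral_nonneg fun x => by positivity
  have hψc := hsmooth.continuous
  have hfc : Continuous (fderiv ℝ ψ) := hsmooth.continuous_fderiv (by simp)
  have hrc := (contDiff_radPot hsmooth).continuous
  have hne : ∀ᵐ x : E3, x ≠ 0 := Measure.ae_ne volume 0
  set δ : ℕ → ℝ := fun n => 1 / ((n : ℝ) + 1) with hδdef
  have hδ : ∀ n, 0 < δ n := fun n => Nat.one_div_pos_of_nat
  have hδ0 : Tendsto δ atTop (nhds 0) := tendsto_one_div_add_atTop_nhds_zero_nat
  have hlim : Tendsto (fun n => ∫ x, (wt (δ n) x * ‖ψ x‖ ^ 2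
      + δ n ^ 2 * wt (δ n) x ^ 3 * radPot ψ x)) atTop (nhds (∫ x : E3, ‖ψ x‖ ^ 2 / ‖x‖)) := by
    refine tendsto_integral_of_dominated_convergence (fun x => 2 * (‖ψ x‖ ^ 2 / ‖x‖)
      + (∑ j, ‖rot j‖) * ‖fderiv ℝ ψ x‖ * ‖ψ x‖) (fun n => ?_) ?_ (fun n => ?_) ?_
    · have hw : Continuous (wt (δ n)) := (contDiff_wt (hδ n)).continuous
      exact Continuous.aestronglyMeasurable (by fun_prop)
    · refine (hint.const_mul 2).add (Continuous.integrable_of_hasCompactSupport (by fun_prop) ?_)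
      exact hsupp.norm.mul_left
    · filter_upwards [hne] with x hx
      have hx' : 0 < ‖x‖ := norm_pos_iff.mpr hx
      have h1 := wt_le_inv (hδ n) hx
      have h2 := (wt_cube_mul_le (hδ n) x).trans h1
      have h0 := wt_nonneg (δ n) x
      have h3 := abs_radPot_le ψ x
      calc _ ≤ |wt (δ n) x * ‖ψ x‖ ^ 2| + |δ n ^ 2 * wt (δ n) x ^ 3 * radPot ψ x| :=
            abs_add_le _ _
        _ = wt (δ n) x * ‖ψ x‖ ^ 2 + δ n ^ 2 * wt (δ n) x ^ 3 * |radPot ψ x| := by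
            rw [abs_mul, abs_mul, abs_of_nonneg h0, abs_of_nonneg (sq_nonneg ‖ψ x‖),
              abs_of_nonneg (by positivity : 0 ≤ δ n ^ 2 * wt (δ n) x ^ 3)]
        _ ≤ ‖x‖⁻¹ * ‖ψ x‖ ^ 2 + ‖x‖⁻¹ *
            (‖ψ x‖ ^ 2 + (∑ j, ‖rot j‖) * ‖fderiv ℝ ψ x‖ * ‖ψ x‖ * ‖x‖) := by gcongr
        _ = _ := by field_simp; ring
    · filter_upwards [hne] with x hx
      have hw := (tendsto_wt hx).comp hδ0
      have := (hw.mul_const (‖ψ x‖ ^ 2)).add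
        (((hδ0.pow 2).mul (hw.pow 3)).mul_const (radPot ψ x))
      simpa [div_eq_inv_mul] using this
  exact le_of_tendsto' hlim fun n => regularized_inequality hsmooth hsupp m ε (hδ n)
end
end

section
/- For every ψ ∈ C_c^∞(ℝ³;ℂ⁴): ∫_{ℝ³} |ψ(x) + (2S·Lψ)(x)|² / |x| dx ≥ ∫_{ℝ³} |ψ(x)|² / |x| dx; that is, the angular operator 1 + 2S·L satisfies |1 + 2S·L| ≥ 1 in the weighted L² sense. -/
open MeasureTheory Real Filter

noncomputable section

lemma inner_real_C4 (u v : C4) : inner ℝ u v =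
    ∑ i, ((u i).re * (v i).re + (u i).im * (v i).im) := by
  simp only [PiLp.inner_apply, Complex.inner, Complex.mul_re, Complex.conj_re, Complex.conj_im]
  exact Finset.sum_congr rfl fun i _ => by ring

lemma mulVecE_spinMat_zero (v : C4) : mulVecE (spinMat 0) v = !₂[v 1, v 0, v 3, v 2] := by
  have h : spinMat 0 = !![0, 1, 0, 0; 1, 0, 0, 0; 0, 0, 0, 1; 0, 0, 1, 0] := by
    ext i j; fin_cases i <;> fin_cases j <;> rfl
  ext i
  fin_cases i <;> simp [mulVecE, h, Matrix.toLpLin_apply, dotProduct, Fin.sum_univ_four]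

lemma mulVecE_spinMat_one (v : C4) : mulVecE (spinMat 1) v =
    !₂[-Complex.I * v 1, Complex.I * v 0, -Complex.I * v 3, Complex.I * v 2] := by
  have h : spinMat 1 = !![0, -Complex.I, 0, 0; Complex.I, 0, 0, 0;
      0, 0, 0, -Complex.I; 0, 0, Complex.I, 0] := by
    ext i j; fin_cases i <;> fin_cases j <;> rfl
  ext i
  fin_cases i <;> simp [mulVecE, h, Matrix.toLpLin_apply, dotProduct, Fin.sum_univ_four]

lemma mulVecE_spinMat_two (v : C4) : mulVecE (spinMat 2) v = !₂[v 0, -v 1, v 2, -v 3] := by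
  have h : spinMat 2 = !![1, 0, 0, 0; 0, -1, 0, 0; 0, 0, 1, 0; 0, 0, 0, -1] := by
    ext i j; fin_cases i <;> fin_cases j <;> rfl
  ext i
  fin_cases i <;> simp [mulVecE, h, Matrix.toLpLin_apply, dotProduct, Fin.sum_univ_four]

/-- Multiplication by `i · diag(σₗ, σₗ)`. -/
def spinGen (l : Fin 3) : C4 →L[ℝ] C4 :=
  LinearMap.toContinuousLinearMap
    (LinearMap.restrictScalars ℝ (Complex.I • Matrix.toEuclideanLin (spinMat l)))

lemma spinGen_apply (l : Fin 3) (v : C4) : spinGen l v = Complex.I • mulVecE (spinMat l) v := rfl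

/-- The contraction `Σₗ diag(σₗ, σₗ) (-i vₗ)`. -/
def spinContract (v : Fin 3 → C4) : C4 :=
  ∑ l, mulVecE (spinMat l) ((-Complex.I) • v l)

lemma norm_sq_C4_s7 (u : C4) : ‖u‖ ^ 2 = inner ℝ u u := (real_inner_self_eq_norm_sq u).symm

lemma norm_sq_spinContract (v : Fin 3 → C4) :
    ‖spinContract v‖ ^ 2 = ∑ l, ‖v l‖ ^ 2 + ∑ l, (inner ℝ (v (l + 1)) (spinGen l (v (l + 2)))
      - inner ℝ (v (l + 2)) (spinGen l (v (l + 1)))) := by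
  simp only [norm_sq_C4_s7, inner_real_C4, spinContract, spinGen_apply, Fin.sum_univ_three,
    mulVecE_spinMat_zero, mulVecE_spinMat_one, mulVecE_spinMat_two]
  simp [Fin.sum_univ_four]
  ring

lemma inner_spinContract (u : C4) (v : Fin 3 → C4) :
    inner ℝ u (spinContract v) = -∑ l, inner ℝ u (spinGen l (v l)) := by
  simp only [inner_real_C4, spinContract, spinGen_apply, Fin.sum_univ_three,
    mulVecE_spinMat_zero, mulVecE_spinMat_one, mulVecE_spinMat_two]
  simp [Fin.sum_univ_four]
  ring

lemma norm_sq_spinContract_cross_identity (x : Fin 3 → ℝ) (g : Fin 3 → C4) (v : Fin 3 → C4)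
    (hv : ∀ l, v l = x (l + 1) • g (l + 2) - x (l + 2) • g (l + 1)) :
    2 * (∑ l, x l ^ 2) * (2 * ∑ l, ‖v l‖ ^ 2 - ‖spinContract v‖ ^ 2) =
      ∑ j, ‖∑ l, x l • spinGen l (v j) - (x (j + 1) • v (j + 2) - x (j + 2) • v (j + 1))‖ ^ 2 := by
  simp only [norm_sq_C4_s7, inner_real_C4, spinContract, spinGen_apply, Fin.sum_univ_three,
    mulVecE_spinMat_zero, mulVecE_spinMat_one, mulVecE_spinMat_two]
  simp [Fin.sum_univ_four, hv]
  ring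

lemma norm_sq_spinContract_cross_le (x : Fin 3 → ℝ) (g : Fin 3 → C4) (v : Fin 3 → C4)
    (hv : ∀ l, v l = x (l + 1) • g (l + 2) - x (l + 2) • g (l + 1)) :
    ‖spinContract v‖ ^ 2 ≤ 2 * ∑ l, ‖v l‖ ^ 2 := by
  have key := norm_sq_spinContract_cross_identity x g v hv
  by_cases hx : x = 0
  · have hv0 : v = 0 := by
      ext1 l
      simp [hv, hx]
    simp [hv0, spinContract, mulVecE]
  · have hpos : 0 < ∑ l, x l ^ 2 := by
      refine lt_of_le_of_ne (Finset.sum_nonneg fun l _ => sq_nonneg _) fun h => hx ?_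
      ext l
      have := (Finset.sum_eq_zero_iff_of_nonneg fun l _ => sq_nonneg (x l)).1 h.symm l
        (Finset.mem_univ l)
      simpa using this
    have hnn : 0 ≤ 2 * (∑ l, x l ^ 2) * (2 * ∑ l, ‖v l‖ ^ 2 - ‖spinContract v‖ ^ 2) := by
      rw [key]
      positivity
    have := nonneg_of_mul_nonneg_right hnn (by positivity)
    linarith

/-- The infinitesimal rotation `x ↦ eₗ × x` of `ℝ³`. -/
def rotGen (l : Fin 3) : E3 →L[ℝ] E3 :=
  (EuclideanSpace.proj (l + 1) : E3 →L[ℝ] ℝ).smulRight (EuclideanSpace.single (l + 2) (1 : ℝ))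
    - (EuclideanSpace.proj (l + 2) : E3 →L[ℝ] ℝ).smulRight (EuclideanSpace.single (l + 1) (1 : ℝ))

lemma rotGen_apply (l : Fin 3) (x : E3) :
    rotGen l x = x (l + 1) • EuclideanSpace.single (l + 2) (1 : ℝ)
      - x (l + 2) • EuclideanSpace.single (l + 1) (1 : ℝ) := rfl

lemma inner_rotGen_self (l : Fin 3) (x : E3) : inner ℝ x (rotGen l x) = 0 := by
  simp [rotGen_apply, inner_sub_right, inner_smul_right, EuclideanSpace.inner_single_right]
  ring

lemma rotGen_commutator (l : Fin 3) (x : E3) :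
    rotGen (l + 2) (rotGen (l + 1) x) - rotGen (l + 1) (rotGen (l + 2) x) = -rotGen l x := by
  ext i
  fin_cases l <;> fin_cases i <;> simp [rotGen_apply]

section RotDeriv

variable {F : Type*} [NormedAddCommGroup F] [NormedSpace ℝ F]

/-- The derivative `((x × ∇)ₗ f)(x)` along infinitesimal rotations. -/
def rotDeriv (l : Fin 3) (f : E3 → F) (x : E3) : F :=
  fderiv ℝ f x (rotGen l x)

lemma rotDeriv_eq (l : Fin 3) (f : E3 → F) (x : E3) :
    rotDeriv l f x = x (l + 1) • fderiv ℝ f x (EuclideanSpace.single (l + 2) 1)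
      - x (l + 2) • fderiv ℝ f x (EuclideanSpace.single (l + 1) 1) := by
  simp [rotDeriv, rotGen_apply]

lemma contDiff_rotDeriv {n m : WithTop ℕ∞} (l : Fin 3) {f : E3 → F} (hf : ContDiff ℝ n f)
    (hmn : m + 1 ≤ n) : ContDiff ℝ m (rotDeriv l f) :=
  (hf.fderiv_right hmn).clm_apply (rotGen l).contDiff

lemma hasCompactSupport_rotDeriv (l : Fin 3) {f : E3 → F} (hf : HasCompactSupport f) :
    HasCompactSupport (rotDeriv l f) :=
  (hf.fderiv ℝ).mono fun x hx hx' => hx (by simp [rotDeriv, hx'])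

lemma norm_rotDeriv_le (l : Fin 3) (f : E3 → F) (x : E3) :
    ‖rotDeriv l f x‖ ≤ ‖x‖ * (‖rotGen l‖ * ‖fderiv ℝ f x‖) := by
  calc ‖rotDeriv l f x‖ ≤ ‖fderiv ℝ f x‖ * ‖rotGen l x‖ := (fderiv ℝ f x).le_opNorm _
    _ ≤ ‖fderiv ℝ f x‖ * (‖rotGen l‖ * ‖x‖) := by gcongr; exact (rotGen l).le_opNorm x
    _ = _ := by ring

lemma rotDeriv_rotDeriv {f : E3 → F} (hf : ContDiff ℝ 2 f) (j k : Fin 3) (x : E3) :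
    rotDeriv j (rotDeriv k f) x = fderiv ℝ (fderiv ℝ f) x (rotGen j x) (rotGen k x)
      + fderiv ℝ f x (rotGen k (rotGen j x)) := by
  have h1 : DifferentiableAt ℝ (fderiv ℝ f) x :=
    (hf.fderiv_right (m := 1) (by norm_num)).differentiable (by norm_num) x
  have h2 : HasFDerivAt (rotDeriv k f) _ x := h1.hasFDerivAt.clm_apply (rotGen k).hasFDerivAt
  simp [rotDeriv, h2.fderiv, add_comm]

lemma rotDeriv_commutator {f : E3 → F} (hf : ContDiff ℝ 2 f) (l : Fin 3) (x : E3) :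
    rotDeriv (l + 1) (rotDeriv (l + 2) f) x - rotDeriv (l + 2) (rotDeriv (l + 1) f) x
      = -rotDeriv l f x := by
  have hs : IsSymmSndFDerivAt ℝ f x := hf.contDiffAt.isSymmSndFDerivAt (by simp)
  rw [rotDeriv_rotDeriv hf, rotDeriv_rotDeriv hf, hs.eq (rotGen (l + 1) x), add_sub_add_left_eq_sub,
    ← map_sub, rotGen_commutator, map_neg, rotDeriv]

end RotDeriv

lemma integral_rotDeriv (l : Fin 3) {f : E3 → ℝ} (hf : ContDiff ℝ 1 f)
    (hfc : HasCompactSupport f) : ∫ x, rotDeriv l f x = 0 := by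
  have hdc : ∀ v, Continuous fun x => fderiv ℝ f x v := fun v =>
    (hf.continuous_fderiv (by norm_num)).clm_apply continuous_const
  have hds : ∀ v, HasCompactSupport fun x => fderiv ℝ f x v := fun v =>
    (hfc.fderiv ℝ).mono fun x hx hx' => hx (by simp [hx'])
  have hInt : ∀ a b : Fin 3, Integrable fun x : E3 =>
      x a * fderiv ℝ f x (EuclideanSpace.single b 1) := fun a b =>
    ((EuclideanSpace.proj a : E3 →L[ℝ] ℝ).continuous.mul (hdc _)).integrable_of_hasCompactSupport
      ((hds _).mul_left)
  have hzero : ∀ a b : Fin 3, a ≠ b →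
      ∫ x : E3, x a * fderiv ℝ f x (EuclideanSpace.single b 1) = 0 := by
    intro a b hab
    have hfd : ∀ x : E3, fderiv ℝ (fun y : E3 => y a) x (EuclideanSpace.single b 1) = 0 := by
      intro x
      have : fderiv ℝ (fun y : E3 => y a) x = EuclideanSpace.proj a :=
        (EuclideanSpace.proj a : E3 →L[ℝ] ℝ).fderiv
      simp [this, hab]
    rw [integral_mul_fderiv_eq_neg_fderiv_mul_of_integrable (f := fun y : E3 => y a)
      (by simp [hfd]) (hInt a b)]
    · simp [hfd]
    · exact ((EuclideanSpace.proj a : E3 →L[ℝ] ℝ).continuous.mul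
        hf.continuous).integrable_of_hasCompactSupport hfc.mul_left
    · exact fun x _ => (EuclideanSpace.proj a : E3 →L[ℝ] ℝ).differentiableAt
    · exact fun x _ => hf.differentiable (by norm_num) x
  simp only [rotDeriv_eq, smul_eq_mul]
  rw [integral_sub (hInt _ _) (hInt _ _), hzero _ _ (by fin_cases l <;> decide),
    hzero _ _ (by fin_cases l <;> decide), sub_zero]

lemma integral_rotDeriv_mul_radial (l : Fin 3) {f : E3 → ℝ} (hf : ContDiff ℝ 1 f)
    (hfc : HasCompactSupport f) {w : E3 → ℝ} (hw : ContDiff ℝ 1 w)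
    (hrad : ∀ x, rotDeriv l w x = 0) : ∫ x, rotDeriv l f x * w x = 0 := by
  rw [← integral_rotDeriv l (hf.mul hw) hfc.mul_right]
  refine integral_congr_ae (Eventually.of_forall fun x => ?_)
  have := hrad x
  simp only [rotDeriv] at this ⊢
  rw [fderiv_fun_mul (hf.differentiable (by norm_num) x) (hw.differentiable (by norm_num) x)]
  simp [this, mul_comm]

/-- The regularisation `(|x|² + ε)^(-1/2)` of `|x|⁻¹`. -/
def regInvNorm (ε : ℝ) (x : E3) : ℝ := (√(‖x‖ ^ 2 + ε))⁻¹

lemma contDiff_regInvNorm {ε : ℝ} (hε : 0 < ε) : ContDiff ℝ 1 (regInvNorm ε) := by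
  have hpos : ∀ x : E3, 0 < ‖x‖ ^ 2 + ε := fun x => by positivity
  exact (((contDiff_norm_sq ℝ).add contDiff_const).sqrt fun x => (hpos x).ne').inv
    fun x => (Real.sqrt_pos.2 (hpos x)).ne'

lemma rotDeriv_regInvNorm {ε : ℝ} (hε : 0 < ε) (l : Fin 3) (x : E3) :
    rotDeriv l (regInvNorm ε) x = 0 := by
  have hpos : 0 < ‖x‖ ^ 2 + ε := by positivity
  have h1 := ((hasStrictFDerivAt_norm_sq x).hasFDerivAt.add_const ε)
  have h2 : DifferentiableAt ℝ (fun t : ℝ => (√t)⁻¹) (‖x‖ ^ 2 + ε) :=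
    ((differentiableAt_id.sqrt hpos.ne').inv (Real.sqrt_pos.2 hpos).ne')
  have h3 : HasFDerivAt (regInvNorm ε) _ x :=
    HasDerivAt.comp_hasFDerivAt (h₂ := fun t : ℝ => (√t)⁻¹) x h2.hasDerivAt h1
  simp [rotDeriv, h3.fderiv, inner_rotGen_self]

lemma regInvNorm_le {ε : ℝ} (hε : 0 < ε) {x : E3} (hx : x ≠ 0) : regInvNorm ε x ≤ ‖x‖⁻¹ := by
  refine inv_anti₀ (norm_pos_iff.2 hx) (Real.le_sqrt_of_sq_le (by linarith))

lemma tendsto_regInvNorm {x : E3} (hx : x ≠ 0) :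
    Tendsto (fun n : ℕ => regInvNorm (1 / ((n : ℝ) + 1)) x) atTop (nhds ‖x‖⁻¹) := by
  have h1 := (tendsto_one_div_add_atTop_nhds_zero_nat (𝕜 := ℝ)).const_add (‖x‖ ^ 2)
  have h2 := h1.sqrt
  rw [add_zero, Real.sqrt_sq (norm_nonneg x)] at h2
  exact h2.inv₀ (norm_ne_zero_iff.2 hx)

lemma integrable_div_norm {f g : E3 → ℝ} (hf : Continuous f) (hg : Continuous g)
    (hgc : HasCompactSupport g) (h : ∀ x, |f x| ≤ ‖x‖ * g x) :
    Integrable fun x => f x / ‖x‖ := by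
  refine (hg.integrable_of_hasCompactSupport hgc).norm.mono'
    (hf.measurable.div measurable_norm).aestronglyMeasurable (Eventually.of_forall fun x => ?_)
  rw [norm_div, norm_norm, Real.norm_eq_abs, Real.norm_eq_abs]
  by_cases hx : x = 0
  · simp [hx]
  · exact ((div_le_iff₀' (norm_pos_iff.2 hx)).2 (h x)).trans (le_abs_self _)

lemma continuous_rotDeriv_bound {F : Type*} [NormedAddCommGroup F] [NormedSpace ℝ F] (l : Fin 3)
    {f : E3 → F} (hf : ContDiff ℝ 1 f) : Continuous fun x => ‖rotGen l‖ * ‖fderiv ℝ f x‖ :=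
  continuous_const.mul (hf.continuous_fderiv (by norm_num)).norm

lemma integrable_rotDeriv_div_norm (l : Fin 3) {f : E3 → ℝ} (hf : ContDiff ℝ 1 f)
    (hfc : HasCompactSupport f) : Integrable fun x => rotDeriv l f x / ‖x‖ :=
  integrable_div_norm (contDiff_rotDeriv (m := 0) l hf (by norm_num)).continuous
    (continuous_rotDeriv_bound l hf) (hfc.fderiv ℝ).norm.mul_left (norm_rotDeriv_le l f)

lemma integral_rotDeriv_div_norm (l : Fin 3) {f : E3 → ℝ} (hf : ContDiff ℝ 1 f)
    (hfc : HasCompactSupport f) : ∫ x, rotDeriv l f x / ‖x‖ = 0 := by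
  have hε : ∀ n : ℕ, 0 < 1 / ((n : ℝ) + 1) := fun n => by positivity
  have hcont := (contDiff_rotDeriv (m := 0) l hf (by norm_num)).continuous
  have hzero : rotDeriv l f 0 = 0 := by simp [rotDeriv]
  have hlim : Tendsto
      (fun n : ℕ => ∫ x, rotDeriv l f x * regInvNorm (1 / ((n : ℝ) + 1)) x) atTop
      (nhds (∫ x, rotDeriv l f x / ‖x‖)) := by
    refine tendsto_integral_of_dominated_convergence (fun x => ‖rotDeriv l f x / ‖x‖‖)
      (fun n => (hcont.mul (contDiff_regInvNorm (hε n)).continuous).aestronglyMeasurable)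
      (integrable_rotDeriv_div_norm l hf hfc).norm
      (fun n => Eventually.of_forall fun x => ?_) (Eventually.of_forall fun x => ?_)
    · by_cases hx : x = 0
      · simp [hx, hzero]
      · have h0 : 0 ≤ regInvNorm (1 / ((n : ℝ) + 1)) x := by unfold regInvNorm; positivity
        rw [norm_mul, norm_div, norm_norm, Real.norm_of_nonneg h0, div_eq_mul_inv ‖_‖ ‖x‖]
        gcongr
        exact regInvNorm_le (hε n) hx
    · by_cases hx : x = 0
      · simp [hx, hzero]
      · simpa [div_eq_mul_inv] using (tendsto_regInvNorm hx).const_mul (rotDeriv l f x)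
  refine tendsto_nhds_unique hlim ?_
  simp only [fun n : ℕ => integral_rotDeriv_mul_radial l hf hfc (contDiff_regInvNorm (hε n))
    (rotDeriv_regInvNorm (hε n) l)]
  exact tendsto_const_nhds

lemma twoSL_eq_spinContract (ψ : E3 → C4) (x : E3) :
    twoSL ψ x = spinContract fun l => rotDeriv l ψ x := by
  simp only [twoSL, spinContract, angMom, rotDeriv_eq, pderiv3]

/-- The current `⟨ψ, i diag(σₗ, σₗ) (x × ∇)ₖ ψ⟩`. -/
def spinCurrent (ψ : E3 → C4) (l k : Fin 3) (x : E3) : ℝ :=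
  inner ℝ (ψ x) (spinGen l (rotDeriv k ψ x))

lemma contDiff_spinCurrent {ψ : E3 → C4} (hψ : ContDiff ℝ 2 ψ) (l k : Fin 3) :
    ContDiff ℝ 1 (spinCurrent ψ l k) :=
  (hψ.of_le (by norm_num)).inner ℝ
    ((spinGen l).contDiff.comp (contDiff_rotDeriv k hψ (by norm_num)))

lemma hasCompactSupport_spinCurrent {ψ : E3 → C4} (hψc : HasCompactSupport ψ) (l k : Fin 3) :
    HasCompactSupport (spinCurrent ψ l k) :=
  hψc.mono fun x hx hx' => hx (by simp [spinCurrent, hx'])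

lemma rotDeriv_spinCurrent {ψ : E3 → C4} (hψ : ContDiff ℝ 2 ψ) (j l k : Fin 3) (x : E3) :
    rotDeriv j (spinCurrent ψ l k) x =
      inner ℝ (ψ x) (spinGen l (rotDeriv j (rotDeriv k ψ) x))
        + inner ℝ (rotDeriv j ψ x) (spinGen l (rotDeriv k ψ x)) := by
  have h1 : DifferentiableAt ℝ (rotDeriv k ψ) x :=
    (contDiff_rotDeriv (m := 1) k hψ (by norm_num)).differentiable (by norm_num) x
  have h2 : HasFDerivAt (fun y => spinGen l (rotDeriv k ψ y))
      ((spinGen l).comp (fderiv ℝ (rotDeriv k ψ) x)) x :=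
    (spinGen l).hasFDerivAt.comp x h1.hasFDerivAt
  have h3 := fderiv_inner_apply ℝ (hψ.differentiable (by norm_num) x) h2.differentiableAt
    (rotGen j x)
  rw [h2.fderiv] at h3
  exact h3

/-- The total angular derivative relating `|ψ + 2S·Lψ|²` to `|ψ|²`. -/
def angDivergence (ψ : E3 → C4) (x : E3) : ℝ :=
  ∑ l, (rotDeriv (l + 1) (spinCurrent ψ l (l + 2)) x
    - rotDeriv (l + 2) (spinCurrent ψ l (l + 1)) x)

lemma angDivergence_eq {ψ : E3 → C4} (hψ : ContDiff ℝ 2 ψ) (x : E3) :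
    angDivergence ψ x = ‖twoSL ψ x‖ ^ 2 + inner ℝ (ψ x) (twoSL ψ x)
      - ∑ l, ‖rotDeriv l ψ x‖ ^ 2 := by
  have h : ∀ l, rotDeriv (l + 1) (spinCurrent ψ l (l + 2)) x
      - rotDeriv (l + 2) (spinCurrent ψ l (l + 1)) x =
      (inner ℝ (rotDeriv (l + 1) ψ x) (spinGen l (rotDeriv (l + 2) ψ x))
        - inner ℝ (rotDeriv (l + 2) ψ x) (spinGen l (rotDeriv (l + 1) ψ x)))
      - inner ℝ (ψ x) (spinGen l (rotDeriv l ψ x)) := by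
    intro l
    have hc := congrArg (fun u => inner ℝ (ψ x) (spinGen l u)) (rotDeriv_commutator hψ l x)
    simp only [map_sub, map_neg, inner_sub_right, inner_neg_right] at hc
    rw [rotDeriv_spinCurrent hψ, rotDeriv_spinCurrent hψ]
    linarith
  rw [twoSL_eq_spinContract, norm_sq_spinContract, inner_spinContract, angDivergence,
    Finset.sum_congr rfl fun l _ => h l, Finset.sum_sub_distrib]
  ring

lemma integrable_angDivergence_div_norm {ψ : E3 → C4} (hψ : ContDiff ℝ 2 ψ)
    (hψc : HasCompactSupport ψ) : Integrable fun x => angDivergence ψ x / ‖x‖ := by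
  simp only [angDivergence, Finset.sum_div, sub_div]
  exact integrable_finsetSum _ fun l _ =>
    (integrable_rotDeriv_div_norm _ (contDiff_spinCurrent hψ _ _)
      (hasCompactSupport_spinCurrent hψc _ _)).sub
    (integrable_rotDeriv_div_norm _ (contDiff_spinCurrent hψ _ _)
      (hasCompactSupport_spinCurrent hψc _ _))

lemma integral_angDivergence_div_norm {ψ : E3 → C4} (hψ : ContDiff ℝ 2 ψ)
    (hψc : HasCompactSupport ψ) : ∫ x, angDivergence ψ x / ‖x‖ = 0 := by
  have hInt : ∀ j l k, Integrable fun x => rotDeriv j (spinCurrent ψ l k) x / ‖x‖ := fun j l k =>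
    integrable_rotDeriv_div_norm j (contDiff_spinCurrent hψ l k)
      (hasCompactSupport_spinCurrent hψc l k)
  have hzero : ∀ j l k, ∫ x, rotDeriv j (spinCurrent ψ l k) x / ‖x‖ = 0 := fun j l k =>
    integral_rotDeriv_div_norm j (contDiff_spinCurrent hψ l k)
      (hasCompactSupport_spinCurrent hψc l k)
  simp only [angDivergence, Finset.sum_div, sub_div]
  rw [integral_finsetSum]
  swap
  · exact fun l _ => (hInt _ _ _).sub (hInt _ _ _)
  exact Finset.sum_eq_zero fun l _ => by
    rw [integral_sub (hInt _ _ _) (hInt _ _ _), hzero, hzero, sub_zero]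

/-- The non-negative density `2 |Lψ|² - |2S·Lψ|²`. -/
def twistorDensity (ψ : E3 → C4) (x : E3) : ℝ :=
  2 * ∑ l, ‖rotDeriv l ψ x‖ ^ 2 - ‖twoSL ψ x‖ ^ 2

lemma twistorDensity_nonneg (ψ : E3 → C4) (x : E3) : 0 ≤ twistorDensity ψ x := by
  rw [twistorDensity, twoSL_eq_spinContract]
  exact sub_nonneg.2 (norm_sq_spinContract_cross_le x
    (fun l => fderiv ℝ ψ x (EuclideanSpace.single l 1)) _ fun l => rotDeriv_eq l ψ x)

lemma integrable_twistorDensity_div_norm {ψ : E3 → C4} (hψ : ContDiff ℝ 1 ψ)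
    (hψc : HasCompactSupport ψ) : Integrable fun x => twistorDensity ψ x / ‖x‖ := by
  have hrot : ∀ l, Continuous (rotDeriv l ψ) := fun l =>
    (contDiff_rotDeriv (m := 0) l hψ (by norm_num)).continuous
  have hSL : Continuous (twoSL ψ) := by
    have h : ∀ j : Fin 3, Continuous (mulVecE (spinMat j)) := fun j =>
      (Matrix.toEuclideanLin (spinMat j)).continuous_of_finiteDimensional
    simp only [funext (twoSL_eq_spinContract ψ), spinContract]
    exact continuous_finsetSum _ fun l _ =>
      (h l).comp ((continuous_const_smul (-Complex.I)).comp (hrot l))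
  refine integrable_div_norm (g := fun x =>
      ∑ l, 2 * ‖rotDeriv l ψ x‖ * (‖rotGen l‖ * ‖fderiv ℝ ψ x‖)) ?_ ?_ ?_ fun x => ?_
  · exact (continuous_const.mul (continuous_finsetSum _ fun l _ => (hrot l).norm.pow 2)).sub
      (hSL.norm.pow 2)
  · exact continuous_finsetSum _ fun l _ =>
      (continuous_const.mul (hrot l).norm).mul (continuous_rotDeriv_bound l hψ)
  · exact (hψc.fderiv ℝ).mono fun x hx hx' => hx (by simp [hx'])
  · rw [abs_of_nonneg (twistorDensity_nonneg ψ x)]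
    calc twistorDensity ψ x ≤ 2 * ∑ l, ‖rotDeriv l ψ x‖ ^ 2 := sub_le_self _ (sq_nonneg _)
      _ = ∑ l, 2 * ‖rotDeriv l ψ x‖ * ‖rotDeriv l ψ x‖ := by
          rw [Finset.mul_sum]
          exact Finset.sum_congr rfl fun l _ => by ring
      _ ≤ ∑ l, 2 * ‖rotDeriv l ψ x‖ * (‖x‖ * (‖rotGen l‖ * ‖fderiv ℝ ψ x‖)) := by
          gcongr with l
          exact norm_rotDeriv_le l ψ x
      _ = _ := by
          rw [Finset.mul_sum]
          exact Finset.sum_congr rfl fun l _ => by ring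

lemma norm_sq_add_twoSL {ψ : E3 → C4} (hψ : ContDiff ℝ 2 ψ) (x : E3) :
    ‖ψ x + twoSL ψ x‖ ^ 2 = ‖ψ x‖ ^ 2 + twistorDensity ψ x + 2 * angDivergence ψ x := by
  rw [norm_add_sq_real, angDivergence_eq hψ, twistorDensity]
  ring

/-- the angular operator 1 + 2S·L has modulus at least one. -/
theorem angular_operator_lower_bound (ψ : E3 → C4) (hsmooth : ContDiff ℝ (⊤ : ℕ∞) ψ)
    (hsupp : HasCompactSupport ψ) :
    (∫ x : E3, ‖ψ x + twoSL ψ x‖ ^ 2 / ‖x‖) ≥ ∫ x : E3, ‖ψ x‖ ^ 2 / ‖x‖ := by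
  have hψ : ContDiff ℝ 2 ψ := contDiff_infty.1 hsmooth 2
  by_cases hB : Integrable fun x : E3 => ‖ψ x‖ ^ 2 / ‖x‖
  · have hN := integrable_twistorDensity_div_norm (hψ.of_le (by norm_num)) hsupp
    have hQ := integrable_angDivergence_div_norm hψ hsupp
    have hN0 : 0 ≤ ∫ x, twistorDensity ψ x / ‖x‖ :=
      integral_nonneg fun x => div_nonneg (twistorDensity_nonneg ψ x) (norm_nonneg x)
    simp only [norm_sq_add_twoSL hψ, add_div, mul_div_assoc]
    have hBN : Integrable fun x : E3 => ‖ψ x‖ ^ 2 / ‖x‖ + twistorDensity ψ x / ‖x‖ := hB.add hN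
    rw [integral_add hBN (hQ.const_mul 2), integral_add hB hN, integral_const_mul,
      integral_angDivergence_div_norm hψ hsupp]
    linarith
  · rw [integral_undef hB]
    exact integral_nonneg fun x => by positivity
end
end
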